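/- arXiv:2605.13291 — 12 statements merged into one kernel-verified Lean document; each statement's English description precedes it below -/
import Mathlib

section
/- Let G be a finite group of weight one whose commutator subgroup [G,G] does not have prime-power order. If the order of G is a product of at most four primes (counted with multiplicity), then |G| is of one of the forms pqr, p^3·q, p^2·q·r, or p·q·r·s, where p, q, r, s denote distinct primes. -/
/-- A group of order `p ^ k` with `p` prime and `k ≤ 2` is commutative. -/
theorem isMulCommutative_of_card_eq_prime_pow {G : Type*} [Group G] {p k : ℕ}
    (hp : p.Prime) (hk : k ≤ 2) (hG : Nat.card G = p ^ k) : IsMulCommutative G := by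
  have : Fact p.Prime := ⟨hp⟩
  interval_cases k
  · have : Subsingleton G := (Nat.card_eq_one_iff_unique.mp (by simpa using hG)).1
    exact ⟨⟨fun _ _ => Subsingleton.elim _ _⟩⟩
  · exact (isCyclic_of_prime_card (by simpa using hG)).isMulCommutative
  · exact IsPGroup.isMulCommutative_of_card_eq_prime_sq hG

/-- If a normal subgroup has prime-power order and its index is `q ^ m` with `q` prime and `m ≤ 2`,
then the commutator subgroup has prime-power order. -/
theorem card_commutator_eq_prime_pow_of_normal {G : Type*} [Group G] {p q k m : ℕ}
    (hp : p.Prime) (hq : q.Prime) (hm : m ≤ 2) (N : Subgroup G) [N.Normal]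
    (hN : Nat.card N = p ^ k) (hindex : N.index = q ^ m) :
    ∃ r l : ℕ, r.Prime ∧ Nat.card (commutator G) = r ^ l := by
  have hle : commutator G ≤ N := Subgroup.Normal.quotient_commutative_iff_commutator_le.mp
    (isMulCommutative_of_card_eq_prime_pow hq hm hindex)
  obtain ⟨l, -, hl⟩ := (Nat.dvd_prime_pow hp).mp (hN ▸ Subgroup.card_dvd_of_le hle)
  exact ⟨p, l, hp, hl⟩

/-- The commutator subgroup of a group of order `p ^ a * q ^ b`, with `p < q` primes and
`a, b ≤ 2`, has prime-power order. -/
theorem card_commutator_eq_prime_pow {G : Type*} [Group G] [Finite G] {p q a b : ℕ}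
    (hp : p.Prime) (hq : q.Prime) (hpq : p < q) (ha : a ≤ 2) (hb : b ≤ 2)
    (hG : Nat.card G = p ^ a * q ^ b) :
    ∃ r l : ℕ, r.Prime ∧ Nat.card (commutator G) = r ^ l := by
  have : Fact q.Prime := ⟨hq⟩
  let P : Sylow q G := default
  have hcard : Nat.card P = q ^ b := by
    rw [P.card_eq_multiplicity, hG,
      Nat.factorization_mul (pow_ne_zero _ hp.ne_zero) (pow_ne_zero _ hq.ne_zero),
      hp.factorization_pow, hq.factorization_pow]
    simp [hpq.ne]
  have hindex : P.index = p ^ a := by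
    have h := (P : Subgroup G).card_mul_index
    rw [hG, show Nat.card (P : Subgroup G) = q ^ b from hcard, mul_comm (p ^ a)] at h
    exact Nat.eq_of_mul_eq_mul_left (pow_pos hq.pos b) h
  obtain ⟨i, hi, hn⟩ := (Nat.dvd_prime_pow hp).mp (hindex ▸ P.card_dvd_index)
  have hmod := card_sylow_modEq_one q G
  rw [hn] at hmod
  have hi2 : i ≤ 2 := hi.trans ha
  interval_cases i
  · have : Subsingleton (Sylow q G) := (Nat.card_eq_one_iff_unique.mp (by simpa using hn)).1
    have : (P : Subgroup G).Normal := P.normal_of_subsingleton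
    exact card_commutator_eq_prime_pow_of_normal hq hp ha (P : Subgroup G) hcard hindex
  · rw [pow_one] at hmod
    exact absurd (hmod.eq_of_lt_of_lt hpq hq.one_lt) hp.ne_one
  · obtain rfl : a = 2 := le_antisymm ha hi
    have heq : (P : Subgroup G) = Subgroup.normalizer (P : Set G) := by
      refine Subgroup.eq_of_le_of_card_ge Subgroup.le_normalizer (le_of_eq ?_)
      have h₁ := (P : Subgroup G).card_mul_index
      have h₂ := (Subgroup.normalizer (P : Set G)).card_mul_index
      rw [← P.card_eq_index_normalizer, hn, ← h₁, hindex] at h₂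
      exact Nat.eq_of_mul_eq_mul_right (pow_pos hp.pos 2) h₂
    have hcomm : IsMulCommutative (P : Subgroup G) :=
      isMulCommutative_of_card_eq_prime_pow hq hb hcard
    have hle : Subgroup.normalizer (P : Set G) ≤ Subgroup.centralizer (P : Set G) :=
      heq.ge.trans (Subgroup.le_centralizer (P : Subgroup G))
    have hcompl := MonoidHom.ker_transferSylow_isComplement' P hle
    refine card_commutator_eq_prime_pow_of_normal hp hq hb (MonoidHom.transferSylow P hle).ker
      (k := 2) ?_ ?_
    · rw [← hcompl.index_eq_card, hindex]
    · rw [hcompl.symm.index_eq_card]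
      exact hcard

/-- The commutator subgroup of a group of prime-power order has prime-power order. -/
theorem card_commutator_eq_prime_pow_of_card {G : Type*} [Group G] {p k : ℕ}
    (hp : p.Prime) (hG : Nat.card G = p ^ k) :
    ∃ r l : ℕ, r.Prime ∧ Nat.card (commutator G) = r ^ l := by
  obtain ⟨l, -, hl⟩ := (Nat.dvd_prime_pow hp).mp (hG ▸ (commutator G).card_subgroup_dvd_card)
  exact ⟨p, l, hp, hl⟩

/-- If a finite group `G` has weight one, its commutator subgroup does not have
prime-power order, and `|G|` is a product of at most four primes (counted with
multiplicity), then `|G|` has one of the forms `p*q*r`, `p^3*q`, `p^2*q*r`, or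
`p*q*r*s` for distinct primes `p, q, r, s`. -/
theorem stmt_1 {G : Type*} [Group G] [Finite G]
    (hw : ∃ g : G, Subgroup.normalClosure {g} = ⊤)
    (hcomm : ¬ ∃ p k : ℕ, p.Prime ∧ Nat.card ↥(commutator G) = p ^ k)
    (hfour : (Nat.card G).primeFactorsList.length ≤ 4) :
    (∃ p q r : ℕ, p.Prime ∧ q.Prime ∧ r.Prime ∧ p ≠ q ∧ p ≠ r ∧ q ≠ r ∧
      Nat.card G = p * q * r) ∨
    (∃ p q : ℕ, p.Prime ∧ q.Prime ∧ p ≠ q ∧ Nat.card G = p ^ 3 * q) ∨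
    (∃ p q r : ℕ, p.Prime ∧ q.Prime ∧ r.Prime ∧ p ≠ q ∧ p ≠ r ∧ q ≠ r ∧
      Nat.card G = p ^ 2 * q * r) ∨
    (∃ p q r s : ℕ, p.Prime ∧ q.Prime ∧ r.Prime ∧ s.Prime ∧
      p ≠ q ∧ p ≠ r ∧ p ≠ s ∧ q ≠ r ∧ q ≠ s ∧ r ≠ s ∧
      Nat.card G = p * q * r * s) := by
  have hpow (p k : ℕ) (hp : p.Prime) : Nat.card G ≠ p ^ k := fun h =>
    hcomm (card_commutator_eq_prime_pow_of_card hp h)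
  have htwo (p q a b : ℕ) (hp : p.Prime) (hq : q.Prime) (hpq : p < q) (ha : a ≤ 2) (hb : b ≤ 2) :
      Nat.card G ≠ p ^ a * q ^ b := fun h =>
    hcomm (card_commutator_eq_prime_pow hp hq hpq ha hb h)
  have hprod := Nat.prod_primeFactorsList (Nat.card_pos (α := G)).ne'
  have hprime := fun p (h : p ∈ (Nat.card G).primeFactorsList) => Nat.prime_of_mem_primeFactorsList h
  have hsorted := (Nat.primeFactorsList_sorted (Nat.card G)).pairwise
  generalize (Nat.card G).primeFactorsList = L at hfour hprod hprime hsorted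
  generalize Nat.card G = n at *
  clear hw hcomm
  match L, hfour with
  | [], _ => exact absurd (by simpa using hprod.symm) (hpow 2 0 Nat.prime_two)
  | [p], _ =>
    simp at hprod hprime
    exact absurd (by simp [hprod]) (hpow p 1 hprime)
  | [p, q], _ =>
    simp at hprod hprime hsorted
    obtain ⟨hp, hq⟩ := hprime
    rcases hsorted.eq_or_lt with rfl | h
    · exact absurd (by rw [← hprod]; ring) (hpow p 2 hp)
    · exact absurd (by rw [← hprod]; ring) (htwo p q 1 1 hp hq h (by simp) (by simp))
  | [p, q, r], _ =>
    simp at hprod hprime hsorted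
    obtain ⟨hp, hq, hr⟩ := hprime
    obtain ⟨⟨h₁, -⟩, h₂⟩ := hsorted
    rcases h₁.eq_or_lt with rfl | h₁ <;> rcases h₂.eq_or_lt with rfl | h₂
    · exact absurd (by rw [← hprod]; ring) (hpow p 3 hp)
    · exact absurd (by rw [← hprod]; ring) (htwo p r 2 1 hp hr h₂ (by simp) (by simp))
    · exact absurd (by rw [← hprod]; ring) (htwo p q 1 2 hp hq h₁ (by simp) (by simp))
    · exact .inl ⟨p, q, r, hp, hq, hr, by omega, by omega, by omega, by rw [← hprod]; ring⟩
  | [p, q, r, s], _ =>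
    simp at hprod hprime hsorted
    obtain ⟨hp, hq, hr, hs⟩ := hprime
    obtain ⟨⟨h₁, -, -⟩, ⟨h₂, -⟩, h₃⟩ := hsorted
    rcases h₁.eq_or_lt with rfl | h₁ <;> rcases h₂.eq_or_lt with rfl | h₂ <;>
      rcases h₃.eq_or_lt with rfl | h₃
    · exact absurd (by rw [← hprod]; ring) (hpow p 4 hp)
    · exact .inr (.inl ⟨p, s, hp, hs, by omega, by rw [← hprod]; ring⟩)
    · exact absurd (by rw [← hprod]; ring) (htwo p r 2 2 hp hr h₂ (by simp) (by simp))
    · exact .inr (.inr (.inl ⟨p, r, s, hp, hr, hs, by omega, by omega, by omega,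
        by rw [← hprod]; ring⟩))
    · exact .inr (.inl ⟨q, p, hq, hp, by omega, by rw [← hprod]; ring⟩)
    · exact .inr (.inr (.inl ⟨q, p, s, hq, hp, hs, by omega, by omega, by omega,
        by rw [← hprod]; ring⟩))
    · exact .inr (.inr (.inl ⟨r, p, q, hr, hp, hq, by omega, by omega, by omega,
        by rw [← hprod]; ring⟩))
    · exact .inr (.inr (.inr ⟨p, q, r, s, hp, hq, hr, hs, by omega, by omega, by omega, by omega,
        by omega, by omega, by rw [← hprod]; ring⟩))
  | _ :: _ :: _ :: _ :: _ :: _, h =>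
    simp at h
    omega
end

section
/- Let p < q be primes with p^2·q^2 ≠ 36. Every finite group G of order p^2·q^2 has a normal Sylow q-subgroup, and its commutator subgroup [G,G] is a q-group. -/
/-- A divisor of `p ^ 2` that is congruent to `1` modulo a prime `q > p` is equal to `1`, unless
`p = 2` and `q = 3`. -/
theorem eq_one_of_dvd_prime_sq_of_modEq_one {p q n : ℕ} (hp : p.Prime) (hq : q.Prime)
    (hpq : p < q) (h36 : p ^ 2 * q ^ 2 ≠ 36) (hn : n ∣ p ^ 2) (hmod : n ≡ 1 [MOD q]) :
    n = 1 := by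
  have hp2 := hp.two_le
  obtain ⟨k, hk, rfl⟩ := (Nat.dvd_prime_pow hp).1 hn
  have hdvd : q ∣ p ^ k - 1 := (Nat.modEq_iff_dvd' (Nat.one_le_pow _ _ hp.pos)).1 hmod.symm
  interval_cases k
  · simp
  · rw [pow_one] at hdvd
    have := Nat.le_of_dvd (by omega) hdvd
    omega
  · rw [← one_pow 2, Nat.sq_sub_sq] at hdvd
    rcases hq.dvd_mul.1 hdvd with h | h
    · have hle := Nat.le_of_dvd (by omega) h
      obtain rfl : q = p + 1 := by omega
      rcases hp.eq_two_or_odd with rfl | hodd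
      · norm_num at h36
      · rcases hq.eq_two_or_odd with h2 | h2 <;> omega
    · have := Nat.le_of_dvd (by omega) h
      omega

/-- For primes `p < q` with `p^2 * q^2 ≠ 36`, every finite group of order `p^2 * q^2`
has a normal Sylow `q`-subgroup, and its commutator subgroup is a `q`-group. -/
theorem stmt_3 {G : Type*} [Group G] [Finite G] {p q : ℕ} (hp : p.Prime) (hq : q.Prime)
    (hpq : p < q) (h36 : p ^ 2 * q ^ 2 ≠ 36) (hcard : Nat.card G = p ^ 2 * q ^ 2) :
    (∃ Q : Sylow q G, (Q : Subgroup G).Normal) ∧ IsPGroup q ↥(commutator G) := by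
  have : Fact p.Prime := ⟨hp⟩
  have : Fact q.Prime := ⟨hq⟩
  let Q : Sylow q G := default
  have hQcard : Nat.card Q = q ^ 2 := by
    rw [Q.card_eq_multiplicity, hcard,
      Nat.factorization_mul (pow_ne_zero 2 hp.ne_zero) (pow_ne_zero 2 hq.ne_zero)]
    simp [hp.factorization, hq.factorization, hpq.ne]
  have hindex : (Q : Subgroup G).index = p ^ 2 := by
    refine Nat.eq_of_mul_eq_mul_left (pow_pos hq.pos 2) ?_
    rw [← hQcard, (Q : Subgroup G).card_mul_index, hcard, hQcard, mul_comm]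
  have hone : Nat.card (Sylow q G) = 1 :=
    eq_one_of_dvd_prime_sq_of_modEq_one hp hq hpq h36 (hindex ▸ Q.card_dvd_index)
      (card_sylow_modEq_one q G)
  have : Subsingleton (Sylow q G) := (Nat.card_eq_one_iff_unique.1 hone).1
  have hnormal : (Q : Subgroup G).Normal := Q.normal_of_subsingleton
  refine ⟨⟨Q, hnormal⟩, Q.isPGroup'.to_le ?_⟩
  exact Subgroup.Normal.quotient_commutative_iff_commutator_le.1
    (IsPGroup.isMulCommutative_of_card_eq_prime_sq (p := p) hindex)
end

section
/- Let p and q be distinct primes and let G be a finite group of order p^3·q having weight one and whose commutator subgroup [G,G] does not have prime-power order. Then |G| = 24 and G is isomorphic to the symmetric group S₄. -/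
open Subgroup

/-- A finite `p`-group that is the normal closure of one element is generated by that element. -/
theorem IsPGroup.zpowers_eq_top_of_normalClosure_eq_top {p : ℕ} [Fact p.Prime] {P : Type*}
    [Group P] [Finite P] (hP : IsPGroup p P) {g : P} (hg : normalClosure {g} = ⊤) :
    zpowers g = ⊤ := by
  have := hP.isNilpotent
  rcases eq_top_or_exists_le_coatom (zpowers g) with h | ⟨M, hM, hle⟩
  · exact h
  · have hn : M.Normal := Group.normalizerCondition_of_isNilpotent.normal_of_coatom M hM
    refine absurd (top_le_iff.mp (hg ▸ normalClosure_le_normal ?_)) hM.1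
    simpa using hle (mem_zpowers g)

/-- In a group of weight one, a normal subgroup whose quotient is a `p`-group contains the
commutator subgroup. -/
theorem commutator_le_of_isPGroup_quotient {p : ℕ} [Fact p.Prime] {G : Type*} [Group G]
    [Finite G] {g : G} (hg : normalClosure {g} = ⊤) (N : Subgroup G) [N.Normal]
    (hN : IsPGroup p (G ⧸ N)) : commutator G ≤ N := by
  have hsurj := QuotientGroup.mk'_surjective N
  have h := map_normalClosure {g} (QuotientGroup.mk' N) hsurj
  rw [hg, map_top_of_surjective _ hsurj, Set.image_singleton] at h
  have hz := hN.zpowers_eq_top_of_normalClosure_eq_top h.symm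
  have : IsCyclic (G ⧸ N) := ⟨_, fun x => hz ▸ mem_top x⟩
  exact Normal.quotient_commutative_iff_commutator_le.mp inferInstance

/-- If a Sylow subgroup is central in its normalizer, then its index is a multiple of the order
of the commutator subgroup. -/
theorem Sylow.card_commutator_dvd_index {q : ℕ} [Fact q.Prime] {G : Type*} [Group G] [Finite G]
    (Q : Sylow q G) (hQ : normalizer (Q : Set G) ≤ centralizer (Q : Set G)) :
    Nat.card (commutator G) ∣ Q.index := by
  have : IsMulCommutative Q := ⟨⟨fun a b => Subtype.ext (hQ (le_normalizer b.2) a a.2)⟩⟩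
  have hle : commutator G ≤ (MonoidHom.transferSylow Q hQ).ker := by
    open scoped IsMulCommutative in
    exact Abelianization.commutator_subset_ker (MonoidHom.transferSylow Q hQ)
  rw [(MonoidHom.ker_transferSylow_isComplement' Q hQ).index_eq_card]
  exact card_dvd_of_le hle

/-- A group of order `24` with four Sylow `3`-subgroups, none of which is central in its
normalizer, is isomorphic to `S₄`. -/
theorem nonempty_mulEquiv_perm_of_card_eq_twentyfour {G : Type*} [Group G] [Finite G]
    (hG : Nat.card G = 24) (h4 : Nat.card (Sylow 3 G) = 4)
    (hc : ∀ Q : Sylow 3 G, ¬ normalizer (Q : Set G) ≤ centralizer (Q : Set G)) :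
    Nonempty (G ≃* Equiv.Perm (Fin 4)) := by
  have : Fact (Nat.Prime 3) := ⟨Nat.prime_three⟩
  have : Fact (Nat.Prime 2) := ⟨Nat.prime_two⟩
  let f := MulAction.toPermHom G (Sylow 3 G)
  have hQ3 (Q : Sylow 3 G) : Nat.card Q = 3 := by
    have h24 : Nat.factorization 24 3 = 1 := by
      rw [Nat.factorization_def _ Nat.prime_three, show 24 = 3 * 8 by rfl,
        padicValNat.mul (by norm_num) (by norm_num), padicValNat.self (by norm_num),
        padicValNat.eq_zero_of_not_dvd (by norm_num)]
    rw [Q.card_eq_multiplicity, hG, h24, pow_one]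
  have hN6 (Q : Sylow 3 G) : Nat.card (normalizer (Q : Set G)) = 6 := by
    have h := card_mul_index (normalizer (Q : Set G))
    rw [← Q.card_eq_index_normalizer, h4, hG] at h
    omega
  have hKN (Q : Sylow 3 G) : f.ker ≤ normalizer (Q : Set G) := fun k hk =>
    Sylow.smul_eq_iff_mem_normalizer.mp (Equiv.congr_fun (MonoidHom.mem_ker.mp hk) Q)
  have h3 : ¬ 3 ∣ Nat.card f.ker := by
    intro h
    obtain ⟨⟨x, hxK⟩, hx⟩ := exists_prime_orderOf_dvd_card' 3 h
    rw [orderOf_mk] at hx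
    have hR : Nat.card (zpowers x) = 3 := by rw [Nat.card_zpowers, hx]
    have hRp : IsPGroup 3 (zpowers x) := IsPGroup.of_card (n := 1) (by rw [hR, pow_one])
    have key (Q : Sylow 3 G) : zpowers x = Q := by
      refine eq_of_le_of_card_ge ?_ (by rw [hR, hQ3])
      have h1 := hRp.inf_normalizer_sylow Q
      rw [inf_eq_left.mpr (zpowers_le.mpr (hKN Q hxK))] at h1
      exact inf_eq_left.mp h1.symm
    have : Subsingleton (Sylow 3 G) := ⟨fun A B => Sylow.ext ((key A).symm.trans (key B))⟩
    have := Finite.card_le_one_iff_subsingleton.mpr this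
    omega
  have h2 : ¬ 2 ∣ Nat.card f.ker := by
    intro h
    let Q : Sylow 3 G := default
    have hdisj : f.ker ⊓ Q = ⊥ := by
      refine (disjoint_of_coprime_natCard ?_).eq_bot
      rw [hQ3]
      exact ((Nat.Prime.coprime_iff_not_dvd Nat.prime_three).mpr h3).symm
    have hKC : f.ker ≤ centralizer (Q : Set G) := by
      intro k hk
      rw [mem_centralizer_iff]
      intro x hx
      have hmem : x * k * x⁻¹ * k⁻¹ ∈ f.ker ⊓ Q := by
        refine mem_inf.mpr ⟨mul_mem (f.normal_ker.conj_mem k hk x) (inv_mem hk), ?_⟩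
        have := (mem_normalizer_iff.mp (hKN Q hk) x⁻¹).mp (inv_mem hx)
        have hmul : x * (k * x⁻¹ * k⁻¹) ∈ (Q : Subgroup G) := mul_mem hx this
        simpa only [mul_assoc] using hmul
      rw [hdisj, mem_bot] at hmem
      exact mul_inv_eq_iff_eq_mul.mp (mul_inv_eq_one.mp hmem)
    have hQC : (Q : Subgroup G) ≤ centralizer (Q : Set G) := by
      have : IsCyclic Q := isCyclic_of_prime_card (hQ3 Q)
      exact le_centralizer Q.toSubgroup
    have hd3 := card_dvd_of_le hQC
    rw [hQ3] at hd3
    have h6 : 2 * 3 ∣ Nat.card (centralizer (Q : Set G)) :=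
      Nat.Coprime.mul_dvd_of_dvd_of_dvd (by norm_num) (h.trans (card_dvd_of_le hKC)) hd3
    have heq := eq_of_le_of_card_ge (centralizer_le_normalizer (Q : Set G))
      (by rw [hN6]; exact Nat.le_of_dvd Nat.card_pos h6)
    exact hc Q heq.ge
  have hK1 : Nat.card f.ker = 1 := by
    have h6 := card_dvd_of_le (hKN default)
    rw [hN6] at h6
    have := Nat.le_of_dvd (by norm_num) h6
    interval_cases Nat.card f.ker <;> omega
  have hinj : Function.Injective f := f.ker_eq_bot_iff.mp (card_eq_one.mp hK1)
  let e : Equiv.Perm (Sylow 3 G) ≃* Equiv.Perm (Fin 4) :=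
    (Finite.equivFinOfCardEq h4).permCongrHom
  have hbij : Function.Bijective (e.toMonoidHom.comp f) := by
    refine (Nat.bijective_iff_injective_and_card _).mpr ⟨e.injective.comp hinj, ?_⟩
    rw [hG, Nat.card_perm, Nat.card_eq_fintype_card, Fintype.card_fin]
    rfl
  exact ⟨MulEquiv.ofBijective _ hbij⟩

/-- For distinct primes `p` and `q`, if a finite group `G` of order `p^3 * q` has
weight one and its commutator subgroup does not have prime-power order, then
`|G| = 24` and `G` is isomorphic to the symmetric group `S₄`. -/
theorem stmt_4 {G : Type*} [Group G] [Finite G] {p q : ℕ} (hp : p.Prime) (hq : q.Prime)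
    (hpq : p ≠ q) (hcard : Nat.card G = p ^ 3 * q)
    (hw : ∃ g : G, Subgroup.normalClosure {g} = ⊤)
    (hcomm : ¬ ∃ r k : ℕ, r.Prime ∧ Nat.card ↥(commutator G) = r ^ k) :
    Nat.card G = 24 ∧ Nonempty (G ≃* Equiv.Perm (Fin 4)) := by
  obtain ⟨g, hg⟩ := hw
  have : Fact p.Prime := ⟨hp⟩
  have : Fact q.Prime := ⟨hq⟩
  have hcomm' {r k : ℕ} (hr : r.Prime) : ¬ Nat.card (commutator G) ∣ r ^ k := fun h => by
    obtain ⟨i, -, hi⟩ := (Nat.dvd_prime_pow hr).mp h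
    exact hcomm ⟨r, i, hr, hi⟩
  let P : Sylow p G := default
  let Q : Sylow q G := default
  have hPcard : Nat.card P = p ^ 3 := by
    rw [P.card_eq_multiplicity, hcard, Nat.factorization_mul (pow_ne_zero _ hp.ne_zero) hq.ne_zero]
    simp [hp.factorization, hq.factorization, hpq.symm]
  have hQcard (R : Sylow q G) : Nat.card R = q := by
    rw [R.card_eq_multiplicity, hcard, Nat.factorization_mul (pow_ne_zero _ hp.ne_zero) hq.ne_zero]
    simp [hp.factorization, hq.factorization, hpq]
  have hPindex : P.index = q := by
    have h := P.card_mul_index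
    rw [hPcard, hcard] at h
    exact Nat.eq_of_mul_eq_mul_left (pow_pos hp.pos 3) h
  have hQindex (R : Sylow q G) : R.index = p ^ 3 := by
    have h := R.card_mul_index
    rw [hQcard, hcard, mul_comm] at h
    exact Nat.eq_of_mul_eq_mul_right hq.pos h
  have hQC (R : Sylow q G) : ¬ normalizer (R : Set G) ≤ centralizer (R : Set G) := fun h =>
    hcomm' hp (hQindex R ▸ R.card_commutator_dvd_index h)
  have hPnormal : ¬ P.Normal := fun h => by
    have hle := commutator_le_of_isPGroup_quotient (p := q) hg P.toSubgroup
      (IsPGroup.of_card (n := 1) (by rw [pow_one, ← hPindex]; rfl))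
    exact hcomm' hp (hPcard ▸ card_dvd_of_le hle)
  have hQnormal : ¬ Q.Normal := fun h => by
    have hle := commutator_le_of_isPGroup_quotient (p := p) hg Q.toSubgroup
      (IsPGroup.of_card (n := 3) (by rw [← hQindex Q]; rfl))
    exact hcomm' hq (k := 1) (by rw [pow_one]; exact hQcard Q ▸ card_dvd_of_le hle)
  have hn {r : ℕ} [Fact r.Prime] (R : Sylow r G) (h : Nat.card (Sylow r G) = 1) : R.Normal := by
    have := Finite.card_le_one_iff_subsingleton.mp h.le
    exact R.normal_of_subsingleton
  have hlt : p < q := by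
    rcases (Nat.dvd_prime hq).mp (hPindex ▸ P.card_dvd_index) with h | h
    · exact absurd (hn P h) hPnormal
    · have hmod : 1 ≡ q [MOD p] := h ▸ (card_sylow_modEq_one p G).symm
      have := Nat.le_of_dvd (by have := hq.two_le; omega) ((Nat.modEq_iff_dvd' hq.one_le).mp hmod)
      have := hq.two_le
      omega
  have hmod : 1 ≡ Nat.card (Sylow q G) [MOD q] := (card_sylow_modEq_one q G).symm
  have hdvd := (Nat.modEq_iff_dvd' Nat.card_pos).mp hmod
  obtain ⟨i, hi, hni⟩ := (Nat.dvd_prime_pow hp).mp (hQindex Q ▸ Q.card_dvd_index)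
  have hp2 := hp.two_le
  have h4 : p = 2 ∧ q = 3 ∧ Nat.card (Sylow q G) = 4 := by
    rw [hni] at hdvd ⊢
    interval_cases i
    · exact absurd (hn Q (by rw [hni, pow_zero])) hQnormal
    · have := Nat.le_of_dvd (by rw [pow_one]; omega) hdvd
      rw [pow_one] at this
      omega
    · have hfac : p ^ 2 - 1 = (p + 1) * (p - 1) := by simpa using Nat.sq_sub_sq p 1
      rw [hfac] at hdvd
      have hqp : q = p + 1 := by
        rcases hq.dvd_mul.mp hdvd with h | h
        · exact le_antisymm (Nat.le_of_dvd (by omega) h) hlt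
        · have := Nat.le_of_dvd (by omega) h
          omega
      have hp2 : p = 2 := by
        rcases hp.eq_two_or_odd with h | h
        · exact h
        · rcases hq.eq_two_or_odd with h' | h' <;> omega
      subst hp2
      exact ⟨rfl, hqp, rfl⟩
    · refine absurd ?_ (hQC Q)
      have hcN : Nat.card (normalizer (Q : Set G)) = q := by
        have h := card_mul_index (normalizer (Q : Set G))
        rw [← Q.card_eq_index_normalizer, hni, hcard, mul_comm] at h
        exact Nat.eq_of_mul_eq_mul_left (pow_pos hp.pos 3) h
      have hQN : (Q : Subgroup G) = normalizer (Q : Set G) :=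
        eq_of_le_of_card_ge le_normalizer (by rw [hcN, hQcard])
      have : IsCyclic Q := isCyclic_of_prime_card (hQcard Q)
      exact hQN.ge.trans (le_centralizer Q.toSubgroup)
  obtain ⟨rfl, rfl, h4⟩ := h4
  have hG : Nat.card G = 24 := hcard
  exact ⟨hG, nonempty_mulEquiv_perm_of_card_eq_twentyfour hG h4 hQC⟩
end

section
/- Let p < q < r be primes with p ∣ q−1 and p ∣ r−1, let a be a unit of ℤ/qℤ of multiplicative order p and b a unit of ℤ/rℤ of multiplicative order p. Let G(pqr;a,b) denote the semidirect product (ℤ/qℤ × ℤ/rℤ) ⋊ ℤ/pℤ in which the generator of ℤ/pℤ acts by multiplication by a on ℤ/qℤ and by multiplication by b on ℤ/rℤ. Then G(pqr;a,b) has weight one and its commutator subgroup equals the normal factor ℤ/qℤ × ℤ/rℤ; in particular, [G,G] is cyclic of order qr and does not have prime-power order. -/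
/-- The automorphism of `ℤ/q × ℤ/r` (written multiplicatively) given by
multiplication by the unit `a` on the first factor and by the unit `b` on the second. -/
def mulAutAB {q r : ℕ} (a : (ZMod q)ˣ) (b : (ZMod r)ˣ) :
    MulAut (Multiplicative (ZMod q × ZMod r)) :=
  AddEquiv.toMultiplicative
    ((DistribMulAction.toAddAut (ZMod q)ˣ (ZMod q) a).prodCongr
      (DistribMulAction.toAddAut (ZMod r)ˣ (ZMod r) b))

namespace SemidirectProduct

variable {N H : Type*} [Group N] [Group H] {φ : H →* MulAut N} {h : H}

open scoped commutatorElement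

theorem inl_eq_commutatorElement (h : H) (m : N) :
    (inl (φ h m * m⁻¹) : N ⋊[φ] H) = ⁅(inr h : N ⋊[φ] H), inl m⁆ := by
  rw [map_mul, inl_aut, map_inv, commutatorElement_def, map_inv]

theorem range_inl_le_commutator (hh : ∀ n : N, ∃ m : N, φ h m * m⁻¹ = n) :
    (inl (φ := φ)).range ≤ commutator (N ⋊[φ] H) := by
  rintro _ ⟨n, rfl⟩
  obtain ⟨m, rfl⟩ := hh n
  rw [inl_eq_commutatorElement]
  exact Subgroup.commutator_mem_commutator (Subgroup.mem_top _) (Subgroup.mem_top _)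

theorem commutator_le_range_inl {N H : Type*} [Group N] [CommGroup H] (φ : H →* MulAut N) :
    commutator (N ⋊[φ] H) ≤ (inl (φ := φ)).range := by
  rw [range_inl_eq_ker_rightHom]
  exact Abelianization.commutator_subset_ker _

theorem normalClosure_inr_eq_top (hh : ∀ n : N, ∃ m : N, φ h m * m⁻¹ = n)
    (hgen : ∀ x : H, x ∈ Subgroup.zpowers h) :
    Subgroup.normalClosure {(inr h : N ⋊[φ] H)} = ⊤ := by
  have hmem : (inr h : N ⋊[φ] H) ∈ Subgroup.normalClosure {(inr h : N ⋊[φ] H)} :=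
    Subgroup.subset_normalClosure rfl
  rw [eq_top_iff]
  intro g _
  rw [← inl_left_mul_inr_right g]
  refine mul_mem ?_ ?_
  · obtain ⟨m, hm⟩ := hh g.left
    rw [← hm, inl_eq_commutatorElement, commutatorElement_def, mul_assoc, mul_assoc,
      ← mul_assoc (inl m)]
    exact mul_mem hmem (Subgroup.normalClosure_normal.conj_mem _ (inv_mem hmem) _)
  · obtain ⟨k, hk⟩ := hgen g.right
    rw [← hk]
    simpa only [map_zpow] using zpow_mem hmem k

end SemidirectProduct

theorem ZMod.exists_unit_mul_sub_eq {n : ℕ} [Fact n.Prime] {u : (ZMod n)ˣ} (hu : u ≠ 1)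
    (x : ZMod n) : ∃ y : ZMod n, (u : ZMod n) * y - y = x := by
  have h : (u : ZMod n) - 1 ≠ 0 := fun h => hu (Units.ext (sub_eq_zero.mp h))
  refine ⟨x / (u - 1), ?_⟩
  field_simp

theorem mulAutAB_mul_inv_surjective {q r : ℕ} [Fact q.Prime] [Fact r.Prime] {a : (ZMod q)ˣ}
    {b : (ZMod r)ˣ} (ha : a ≠ 1) (hb : b ≠ 1) (n : Multiplicative (ZMod q × ZMod r)) :
    ∃ m, mulAutAB a b m * m⁻¹ = n := by
  obtain ⟨x, hx⟩ := ZMod.exists_unit_mul_sub_eq ha n.toAdd.1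
  obtain ⟨y, hy⟩ := ZMod.exists_unit_mul_sub_eq hb n.toAdd.2
  refine ⟨Multiplicative.ofAdd (x, y), Multiplicative.toAdd.injective (Prod.ext ?_ ?_)⟩
  · rw [← hx, sub_eq_add_neg]
    rfl
  · rw [← hy, sub_eq_add_neg]
    rfl

theorem ZMod.mem_zpowers_ofAdd_one {n : ℕ} (x : Multiplicative (ZMod n)) :
    x ∈ Subgroup.zpowers (Multiplicative.ofAdd (1 : ZMod n)) := by
  obtain ⟨k, hk⟩ := ZMod.intCast_surjective x.toAdd
  refine ⟨k, Multiplicative.toAdd.injective ?_⟩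
  simp [hk]

theorem Nat.Prime.mul_ne_prime_pow {q r s : ℕ} (hq : q.Prime) (hr : r.Prime) (hqr : q ≠ r)
    (hs : s.Prime) (k : ℕ) : q * r ≠ s ^ k := by
  intro h
  have hqs := (Nat.prime_dvd_prime_iff_eq hq hs).mp
    (hq.dvd_of_dvd_pow (h ▸ Nat.dvd_mul_right q r))
  have hrs := (Nat.prime_dvd_prime_iff_eq hr hs).mp
    (hr.dvd_of_dvd_pow (h ▸ Nat.dvd_mul_left r q))
  exact hqr (hqs.trans hrs.symm)

/-- Let `p < q < r` be primes with `p ∣ q - 1`, `p ∣ r - 1`, let `a` be a unit of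
`ℤ/q` of order `p` and `b` a unit of `ℤ/r` of order `p`.  The group `G(pqr; a, b)`
is the semidirect product `(ℤ/q × ℤ/r) ⋊ ℤ/p` in which the generator `1` of `ℤ/p`
acts via multiplication by `a` and `b` on the two factors (i.e. via the structure
homomorphism `φ` with `φ 1 = mulAutAB a b`).  It has weight one, its commutator
subgroup equals the normal factor `ℤ/q × ℤ/r` (the range of `inl`), and is cyclic of
order `q * r`; in particular it does not have prime-power order. -/
theorem stmt_5 {p q r : ℕ} (hp : p.Prime) (hq : q.Prime) (hr : r.Prime)
    (hpq : p < q) (hqr : q < r) (hdq : p ∣ q - 1) (hdr : p ∣ r - 1)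
    (a : (ZMod q)ˣ) (b : (ZMod r)ˣ) (ha : orderOf a = p) (hb : orderOf b = p)
    (φ : Multiplicative (ZMod p) →* MulAut (Multiplicative (ZMod q × ZMod r)))
    (hφ : φ (Multiplicative.ofAdd (1 : ZMod p)) = mulAutAB a b) :
    (∃ g : Multiplicative (ZMod q × ZMod r) ⋊[φ] Multiplicative (ZMod p),
      Subgroup.normalClosure {g} = ⊤) ∧
    commutator (Multiplicative (ZMod q × ZMod r) ⋊[φ] Multiplicative (ZMod p)) =
      (SemidirectProduct.inl (φ := φ)).range ∧
    IsCyclic ↥(commutator (Multiplicative (ZMod q × ZMod r) ⋊[φ] Multiplicative (ZMod p))) ∧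
    Nat.card ↥(commutator (Multiplicative (ZMod q × ZMod r) ⋊[φ] Multiplicative (ZMod p)))
      = q * r ∧
    ¬ ∃ s k : ℕ, s.Prime ∧
      Nat.card ↥(commutator (Multiplicative (ZMod q × ZMod r) ⋊[φ] Multiplicative (ZMod p)))
        = s ^ k := by
  have : Fact q.Prime := ⟨hq⟩
  have : Fact r.Prime := ⟨hr⟩
  have ha1 : a ≠ 1 := fun h => hp.ne_one (by rw [← ha, h, orderOf_one])
  have hb1 : b ≠ 1 := fun h => hp.ne_one (by rw [← hb, h, orderOf_one])
  have hsurj : ∀ n, ∃ m, φ (Multiplicative.ofAdd (1 : ZMod p)) m * m⁻¹ = n := by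
    rw [hφ]
    exact mulAutAB_mul_inv_surjective ha1 hb1
  have hcomm := le_antisymm (SemidirectProduct.commutator_le_range_inl φ)
    (SemidirectProduct.range_inl_le_commutator hsurj)
  have e := MonoidHom.ofInjective (SemidirectProduct.inl_injective (φ := φ))
  have hcard : Nat.card (SemidirectProduct.inl (φ := φ)).range = q * r := by
    rw [← Nat.card_congr e.toEquiv, Nat.card_congr Multiplicative.toAdd, Nat.card_prod,
      Nat.card_zmod, Nat.card_zmod]
  have hcop : q.Coprime r := (Nat.coprime_primes hq hr).mpr hqr.ne
  refine ⟨⟨_, SemidirectProduct.normalClosure_inr_eq_top hsurj ZMod.mem_zpowers_ofAdd_one⟩,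
    hcomm, ?_⟩
  rw [hcomm, hcard]
  refine ⟨?_, rfl, fun ⟨s, k, hs, h⟩ => hq.mul_ne_prime_pow hr hqr.ne hs k h⟩
  exact isCyclic_of_surjective
    (e.toMonoidHom.comp (AddEquiv.toMultiplicative (ZMod.chineseRemainder hcop).toAddEquiv).toMonoidHom)
    (e.surjective.comp (AddEquiv.toMultiplicative (ZMod.chineseRemainder hcop).toAddEquiv).surjective)
end

section
/- Let p < q < r be primes and let G be a finite group of order p·q·r whose commutator subgroup [G,G] does not have prime-power order. Then p divides q−1 and p divides r−1, the commutator subgroup [G,G] is cyclic of order q·r, the abelianization G/[G,G] is cyclic of order p, and G is isomorphic to a semidirect product (ℤ/qℤ × ℤ/rℤ) ⋊ ℤ/pℤ in which the generator of ℤ/pℤ acts by multiplication by a unit of order p on each of the two factors. -/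
theorem mulAutAB_ofAdd {q r : ℕ} (a : (ZMod q)ˣ) (b : (ZMod r)ˣ) (x : ZMod q) (y : ZMod r) :
    mulAutAB a b (Multiplicative.ofAdd (x, y)) = Multiplicative.ofAdd (a * x, b * y) :=
  rfl

theorem mulAutAB_pow {q r : ℕ} (a : (ZMod q)ˣ) (b : (ZMod r)ˣ) (n : ℕ) :
    mulAutAB a b ^ n = mulAutAB (a ^ n) (b ^ n) := by
  induction n with
  | zero =>
    ext x : 1
    change x = Multiplicative.ofAdd _
    simp only [pow_zero]
    change x = Multiplicative.ofAdd ((1 : ZMod q) * x.toAdd.1, (1 : ZMod r) * x.toAdd.2)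
    simp
  | succ n ih =>
    ext x : 1
    rw [pow_succ, ih, MulAut.mul_apply]
    change Multiplicative.ofAdd ((_ : ZMod q) * (_ * x.toAdd.1), (_ : ZMod r) * (_ * x.toAdd.2)) =
      Multiplicative.ofAdd ((_ : ZMod q) * x.toAdd.1, (_ : ZMod r) * x.toAdd.2)
    simp only [pow_succ, Units.val_mul, mul_assoc]

theorem eq_one_of_mulAutAB_eq_one {q r : ℕ} {a : (ZMod q)ˣ} {b : (ZMod r)ˣ}
    (h : mulAutAB a b = 1) : a = 1 ∧ b = 1 := by
  have h1 := DFunLike.congr_fun h (Multiplicative.ofAdd (1, 1))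
  rw [mulAutAB_ofAdd, MulAut.one_apply, Multiplicative.ofAdd.injective.eq_iff] at h1
  simpa using h1

theorem isCyclic_multiplicative_zmod_prod {q r : ℕ} (h : q.Coprime r) :
    IsCyclic (Multiplicative (ZMod q × ZMod r)) := by
  have : IsAddCyclic (ZMod q × ZMod r) :=
    isAddCyclic_of_surjective (ZMod.chineseRemainder h).toAddEquiv
      (ZMod.chineseRemainder h).surjective
  infer_instance

theorem exists_eq_mulAutAB {q r : ℕ} (h : q.Coprime r)
    (f : MulAut (Multiplicative (ZMod q × ZMod r))) :
    ∃ (a : (ZMod q)ˣ) (b : (ZMod r)ˣ), f = mulAutAB a b := by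
  have := isCyclic_multiplicative_zmod_prod h
  obtain ⟨m, hm⟩ := MonoidHom.map_cyclic f.toMonoidHom
  replace hm : ∀ x y, f (Multiplicative.ofAdd (x, y)) =
      Multiplicative.ofAdd ((m : ZMod q) * x, (m : ZMod r) * y) := by
    intro x y
    refine (hm _).trans ?_
    rw [← ofAdd_zsmul]
    simp
  obtain ⟨z, hz⟩ := f.surjective (Multiplicative.ofAdd (1, 1))
  have hz' := (hm z.toAdd.1 z.toAdd.2).symm.trans hz
  rw [Multiplicative.ofAdd.injective.eq_iff, Prod.mk.injEq] at hz'
  refine ⟨Units.mkOfMulEqOne _ _ hz'.1, Units.mkOfMulEqOne _ _ hz'.2, ?_⟩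
  ext x : 1
  exact hm x.toAdd.1 x.toAdd.2

/-- A homomorphism from `N` to a commutative group that is invariant under the action of a
generator of the cyclic group `K` kills the intersection of `N` with the commutator subgroup of
`N ⋊ K`. -/
theorem SemidirectProduct.map_eq_one_of_inl_mem_commutator {N K A : Type*} [Group N] [Group K]
    [CommGroup A] {φ : K →* MulAut N} {g : K} (hg : ∀ k : K, k ∈ Submonoid.powers g)
    (f : N →* A) (hf : ∀ x, f (φ g x) = f x) {x : N}
    (hx : (SemidirectProduct.inl x : N ⋊[φ] K) ∈ commutator (N ⋊[φ] K)) : f x = 1 := by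
  have key : ∀ k x, f (φ k x) = f x := by
    intro k
    obtain ⟨n, rfl⟩ := hg k
    induction n with
    | zero => simp
    | succ n ih =>
      intro x
      simp only [pow_succ, map_mul, MulAut.mul_apply] at ih ⊢
      rw [ih, hf]
  let ψ : N ⋊[φ] K →* A := SemidirectProduct.lift f 1 fun k ↦ by
    ext x
    simpa using key k x
  have h := Abelianization.commutator_subset_ker ψ hx
  simpa [ψ, MonoidHom.mem_ker] using h

/-- A finite Z-group whose commutator subgroup has order `q * r` and prime index `p`, where `q` and
`r` are distinct primes, is a semidirect product of `ℤ/q × ℤ/r` by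
`ℤ/p`, with `ℤ/p` acting faithfully on each factor. -/
theorem exists_mulEquiv_semidirectProduct_of_card_commutator {G : Type*} [Group G] [Finite G]
    [IsZGroup G] {p q r : ℕ} (hp : p.Prime) (hq : q.Prime) (hr : r.Prime) (hqr : q ≠ r)
    (hcard : Nat.card (commutator G) = q * r) (hindex : (commutator G).index = p) :
    ∃ (a : (ZMod q)ˣ) (b : (ZMod r)ˣ)
      (φ : Multiplicative (ZMod p) →* MulAut (Multiplicative (ZMod q × ZMod r))),
      orderOf a = p ∧ orderOf b = p ∧
      φ (Multiplicative.ofAdd (1 : ZMod p)) = mulAutAB a b ∧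
      Nonempty (G ≃* Multiplicative (ZMod q × ZMod r) ⋊[φ] Multiplicative (ZMod p)) := by
  have := Fact.mk hp
  have := Fact.mk hq
  have := Fact.mk hr
  have hcop : q.Coprime r := (Nat.coprime_primes hq hr).2 hqr
  have := isCyclic_multiplicative_zmod_prod hcop
  have := IsZGroup.isCyclic_commutator (G := G)
  obtain ⟨H, hH⟩ :=
    Subgroup.exists_right_complement'_of_coprime (IsZGroup.coprime_commutator_index G)
  have hHcard : Nat.card H = p := by rw [← hH.symm.index_eq_card, hindex]
  let eN : commutator G ≃* Multiplicative (ZMod q × ZMod r) :=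
    mulEquivOfCyclicCardEq (by simp [hcard])
  let eH : H ≃* Multiplicative (ZMod p) := mulEquivOfPrimeCardEq (p := p) hHcard (by simp)
  obtain ⟨φ₀, e₀, he₀⟩ : ∃ (φ₀ : H →* MulAut (commutator G)) (e₀ : commutator G ⋊[φ₀] H ≃* G),
      ∀ x, e₀ (SemidirectProduct.inl x) = x :=
    ⟨_, SemidirectProduct.mulEquivSubgroup hH, fun x ↦ by simp⟩
  obtain ⟨φ, e, he⟩ : ∃ (φ : Multiplicative (ZMod p) →* MulAut (Multiplicative (ZMod q × ZMod r)))
      (e : G ≃* Multiplicative (ZMod q × ZMod r) ⋊[φ] Multiplicative (ZMod p)),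
      ∀ x : commutator G, e x = SemidirectProduct.inl (eN x) := by
    refine ⟨_, e₀.symm.trans (SemidirectProduct.congr' eN eH), fun x ↦ ?_⟩
    rw [MulEquiv.trans_apply, ← he₀ x, MulEquiv.symm_apply_apply]
    ext <;> simp
  have hmem : ∀ x, SemidirectProduct.inl x ∈ commutator
      (Multiplicative (ZMod q × ZMod r) ⋊[φ] Multiplicative (ZMod p)) := by
    intro x
    have hle : (commutator G).map e.toMonoidHom ≤ commutator _ := by
      rw [commutator_def, commutator_def, Subgroup.map_commutator]
      exact Subgroup.commutator_mono le_top le_top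
    have hx := he (eN.symm x)
    rw [MulEquiv.apply_symm_apply] at hx
    rw [← hx]
    exact hle (Subgroup.mem_map_of_mem _ (eN.symm x).2)
  obtain ⟨a, b, hab⟩ := exists_eq_mulAutAB hcop (φ (Multiplicative.ofAdd 1))
  have hgen : ∀ k : Multiplicative (ZMod p),
      k ∈ Submonoid.powers (Multiplicative.ofAdd (1 : ZMod p)) := by
    intro k
    refine ⟨k.toAdd.val, ?_⟩
    simp [← ofAdd_nsmul]
  have hpow : a ^ p = 1 ∧ b ^ p = 1 := by
    apply eq_one_of_mulAutAB_eq_one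
    rw [← mulAutAB_pow, ← hab, ← map_pow, ← ofAdd_nsmul]
    simp
  refine ⟨a, b, φ, orderOf_eq_prime hpow.1 ?_, orderOf_eq_prime hpow.2 ?_, hab, ⟨e⟩⟩
  · rintro rfl
    have h1 := SemidirectProduct.map_eq_one_of_inl_mem_commutator hgen
      (AddMonoidHom.toMultiplicative (AddMonoidHom.fst (ZMod q) (ZMod r)))
      (fun x ↦ by
        rw [hab]
        change Multiplicative.ofAdd ((1 : ZMod q) * x.toAdd.1) = Multiplicative.ofAdd x.toAdd.1
        rw [one_mul])
      (hmem (Multiplicative.ofAdd (1, 0)))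
    exact one_ne_zero (α := ZMod q) (Multiplicative.ofAdd.injective h1)
  · rintro rfl
    have h1 := SemidirectProduct.map_eq_one_of_inl_mem_commutator hgen
      (AddMonoidHom.toMultiplicative (AddMonoidHom.snd (ZMod q) (ZMod r)))
      (fun x ↦ by
        rw [hab]
        change Multiplicative.ofAdd ((1 : ZMod r) * x.toAdd.2) = Multiplicative.ofAdd x.toAdd.2
        rw [one_mul])
      (hmem (Multiplicative.ofAdd (0, 1)))
    exact one_ne_zero (α := ZMod r) (Multiplicative.ofAdd.injective h1)

theorem ZMod.orderOf_dvd_sub_one {q : ℕ} (hq : q.Prime) (a : (ZMod q)ˣ) : orderOf a ∣ q - 1 := by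
  have := Fact.mk hq
  exact orderOf_dvd_of_pow_eq_one (ZMod.units_pow_card_sub_one_eq_one q a)

/-- Let `p < q < r` be primes and `G` a finite group of order `p * q * r` whose
commutator subgroup does not have prime-power order.  Then `p ∣ q - 1`, `p ∣ r - 1`,
the commutator subgroup is cyclic of order `q * r`, the abelianization is cyclic of
order `p`, and `G` is isomorphic to a semidirect product
`(ℤ/q × ℤ/r) ⋊ ℤ/p` in which the generator of `ℤ/p` acts by multiplication by a
unit of order `p` on each of the two factors. -/
theorem stmt_6 {G : Type*} [Group G] [Finite G] {p q r : ℕ}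
    (hp : p.Prime) (hq : q.Prime) (hr : r.Prime) (hpq : p < q) (hqr : q < r)
    (hcard : Nat.card G = p * q * r)
    (hcomm : ¬ ∃ s k : ℕ, s.Prime ∧ Nat.card ↥(commutator G) = s ^ k) :
    p ∣ q - 1 ∧ p ∣ r - 1 ∧
    IsCyclic ↥(commutator G) ∧ Nat.card ↥(commutator G) = q * r ∧
    IsCyclic (Abelianization G) ∧ Nat.card (Abelianization G) = p ∧
    ∃ (a : (ZMod q)ˣ) (b : (ZMod r)ˣ)
      (φ : Multiplicative (ZMod p) →* MulAut (Multiplicative (ZMod q × ZMod r))),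
      orderOf a = p ∧ orderOf b = p ∧
      φ (Multiplicative.ofAdd (1 : ZMod p)) = mulAutAB a b ∧
      Nonempty (G ≃* Multiplicative (ZMod q × ZMod r) ⋊[φ] Multiplicative (ZMod p)) := by
  have hsq : Squarefree (Nat.card G) := by
    have hpq' := (Nat.coprime_primes hp hq).2 hpq.ne
    have hpr' := (Nat.coprime_primes hp hr).2 (hpq.trans hqr).ne
    have hqr' := (Nat.coprime_primes hq hr).2 hqr.ne
    rw [hcard, Nat.squarefree_mul (Nat.Coprime.mul_left hpr' hqr'), Nat.squarefree_mul hpq']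
    exact ⟨⟨hp.squarefree, hq.squarefree⟩, hr.squarefree⟩
  have := IsZGroup.of_squarefree hsq
  have : Nontrivial G := by
    by_contra h
    rw [not_nontrivial_iff_subsingleton] at h
    exact hcomm ⟨2, 0, Nat.prime_two, by simp⟩
  have hlt : (commutator G).index ≠ 1 := by
    rw [Ne, Subgroup.index_eq_one]
    exact (IsZGroup.commutator_lt (G := G)).ne
  have hmul := (commutator G).card_mul_index
  rw [hcard] at hmul
  have hpos := hp.pos
  have hqpos := hq.pos
  have hrpos := hr.pos
  have hcases : Nat.card (commutator G) = q * r ∧ (commutator G).index = p := by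
    obtain ⟨n', k₃, hn', hk₃, hn⟩ := (Nat.dvd_mul).1 (Dvd.intro _ hmul)
    obtain ⟨k₁, k₂, hk₁, hk₂, rfl⟩ := (Nat.dvd_mul).1 hn'
    rcases (Nat.dvd_prime hp).1 hk₁ with rfl | rfl <;>
    rcases (Nat.dvd_prime hq).1 hk₂ with rfl | rfl <;>
    rcases (Nat.dvd_prime hr).1 hk₃ with rfl | rfl
    · exact absurd ⟨2, 0, Nat.prime_two, by simp [← hn]⟩ hcomm
    · exact absurd ⟨k₃, 1, hr, by simp [← hn]⟩ hcomm
    · exact absurd ⟨k₂, 1, hq, by simp [← hn]⟩ hcomm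
    · refine ⟨by simp [← hn], ?_⟩
      rw [← hn] at hmul
      exact Nat.eq_of_mul_eq_mul_left (mul_pos hqpos hrpos) (by linarith)
    · exact absurd ⟨k₁, 1, hp, by simp [← hn]⟩ hcomm
    · have hi : (commutator G).index = q := by
        rw [← hn] at hmul
        exact Nat.eq_of_mul_eq_mul_left (mul_pos hpos hrpos) (by linarith)
      obtain ⟨a, -, -, ha, -⟩ := exists_mulEquiv_semidirectProduct_of_card_commutator hq hp hr
        (hpq.trans hqr).ne (by simp [← hn]) hi
      have := Nat.le_of_dvd (Nat.sub_pos_of_lt hp.one_lt)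
        (ha ▸ ZMod.orderOf_dvd_sub_one hp a)
      omega
    · have hi : (commutator G).index = r := by
        rw [← hn] at hmul
        exact Nat.eq_of_mul_eq_mul_left (mul_pos hpos hqpos) (by linarith)
      obtain ⟨a, -, -, ha, -⟩ := exists_mulEquiv_semidirectProduct_of_card_commutator hr hp hq
        hpq.ne (by simp [← hn]) hi
      have := Nat.le_of_dvd (Nat.sub_pos_of_lt hp.one_lt)
        (ha ▸ ZMod.orderOf_dvd_sub_one hp a)
      omega
    · rw [← hn] at hmul
      exact absurd (Nat.eq_of_mul_eq_mul_left (mul_pos (mul_pos hpos hqpos) hrpos)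
        (by linarith)) hlt
  obtain ⟨hN, hi⟩ := hcases
  obtain ⟨a, b, φ, ha, hb, h⟩ :=
    exists_mulEquiv_semidirectProduct_of_card_commutator hp hq hr hqr.ne hN hi
  exact ⟨ha ▸ ZMod.orderOf_dvd_sub_one hq a, hb ▸ ZMod.orderOf_dvd_sub_one hr b,
    IsZGroup.isCyclic_commutator G, hN, inferInstance, hi, a, b, φ, ha, hb, h⟩
end

section
/- Let p < q < r be primes with p ∣ q−1 and p ∣ r−1, let a be a unit of ℤ/qℤ of multiplicative order p and b a unit of ℤ/rℤ of multiplicative order p. Then for every i with 1 ≤ i ≤ p−1, the groups G(pqr;a^i,b^i) and G(pqr;a,b) are isomorphic. -/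
theorem mulAutAB_apply {q r : ℕ} (a : (ZMod q)ˣ) (b : (ZMod r)ˣ)
    (x : Multiplicative (ZMod q × ZMod r)) :
    mulAutAB a b x = Multiplicative.ofAdd (a • x.toAdd.1, b • x.toAdd.2) :=
  rfl

/-- Homomorphisms out of `ℤ/n`, written multiplicatively, agree if they agree at the generator. -/
theorem ZMod.multiplicative_hom_ext {n : ℕ} [NeZero n] {M : Type*} [Monoid M]
    {f g : Multiplicative (ZMod n) →* M}
    (h : f (Multiplicative.ofAdd 1) = g (Multiplicative.ofAdd 1)) : f = g := by
  refine MonoidHom.ext fun x ↦ ?_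
  have hx : x = Multiplicative.ofAdd (1 : ZMod n) ^ ZMod.val (Multiplicative.toAdd x) := by
    rw [← ofAdd_nsmul, nsmul_one, ZMod.natCast_zmod_val, ofAdd_toAdd]
  rw [hx, map_pow, map_pow, h]

/-- If the acting group is abelian and finite, replacing the action `φ` by its precomposition with a
power map coprime to the order does not change the semidirect product. -/
theorem SemidirectProduct.nonempty_mulEquiv_comp_powMonoidHom {N G : Type*} [Group N] [CommGroup G]
    (φ : G →* MulAut N) {n : ℕ} (hn : (Nat.card G).Coprime n) :
    Nonempty ((N ⋊[φ.comp (powMonoidHom n)] G) ≃* (N ⋊[φ] G)) :=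
  ⟨SemidirectProduct.congr (MulEquiv.refl N)
    (MulEquiv.ofBijective (powMonoidHom n) (powCoprime hn).bijective) fun _ ↦ rfl⟩

/-- Let `p < q < r` be primes with `p ∣ q - 1`, `p ∣ r - 1`, let `a` be a unit of
`ℤ/q` of order `p` and `b` a unit of `ℤ/r` of order `p`.  For every `i` with
`1 ≤ i ≤ p - 1`, the groups `G(pqr; a^i, b^i)` and `G(pqr; a, b)` (the semidirect
products `(ℤ/q × ℤ/r) ⋊ ℤ/p` whose structure maps `φ₁`, `φ₂` send the generator `1`
of `ℤ/p` to multiplication by `(a^i, b^i)` resp. `(a, b)`) are isomorphic. -/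
theorem stmt_7 {p q r : ℕ} (hp : p.Prime) (hq : q.Prime) (hr : r.Prime)
    (hpq : p < q) (hqr : q < r) (hdq : p ∣ q - 1) (hdr : p ∣ r - 1)
    (a : (ZMod q)ˣ) (b : (ZMod r)ˣ) (ha : orderOf a = p) (hb : orderOf b = p)
    (i : ℕ) (hi1 : 1 ≤ i) (hi2 : i ≤ p - 1)
    (φ₁ φ₂ : Multiplicative (ZMod p) →* MulAut (Multiplicative (ZMod q × ZMod r)))
    (hφ₁ : φ₁ (Multiplicative.ofAdd (1 : ZMod p)) = mulAutAB (a ^ i) (b ^ i))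
    (hφ₂ : φ₂ (Multiplicative.ofAdd (1 : ZMod p)) = mulAutAB a b) :
    Nonempty ((Multiplicative (ZMod q × ZMod r) ⋊[φ₁] Multiplicative (ZMod p)) ≃*
      (Multiplicative (ZMod q × ZMod r) ⋊[φ₂] Multiplicative (ZMod p))) := by
  have : NeZero p := ⟨hp.ne_zero⟩
  have hi : (Nat.card (Multiplicative (ZMod p))).Coprime i := by
    rw [Nat.card_congr Multiplicative.toAdd, Nat.card_zmod]
    exact Nat.coprime_of_lt_prime (by omega) (by have := hp.pos; omega) hp
  obtain rfl : φ₁ = φ₂.comp (powMonoidHom i) := by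
    apply ZMod.multiplicative_hom_ext
    rw [MonoidHom.comp_apply, powMonoidHom_apply, map_pow, hφ₂, hφ₁, mulAutAB_pow]
  exact SemidirectProduct.nonempty_mulEquiv_comp_powMonoidHom φ₂ hi
end

section
/- Let n be a square-free natural number. The number of isomorphism classes of finite groups of order n whose commutator subgroup has prime-power order (i.e., is trivial or of prime order) equals 1 + Σ_{p ∈ π(n)} (2^{c̄_n(p)} − 1), where π(n) is the set of primes dividing n and c̄_n(p) is the number of primes q dividing n such that q divides p−1. -/
/-- The multiplication underlying a group structure `s` on a type `α`. -/
def groupMul {α : Type*} (s : Group α) : Mul α := by letI := s; infer_instance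

/-- The setoid identifying isomorphic group structures (satisfying a predicate `P`)
on the carrier `Fin n`; its quotient is the set of isomorphism classes of groups of
order `n` satisfying `P`. -/
def isoSetoid {n : ℕ} (P : Group (Fin n) → Prop) : Setoid {s : Group (Fin n) // P s} where
  r s t := Nonempty (@MulEquiv (Fin n) (Fin n) (groupMul s.1) (groupMul t.1))
  iseqv := by
    refine ⟨fun s => ⟨@MulEquiv.refl _ (groupMul s.1)⟩, ?_, ?_⟩
    · rintro s t ⟨e⟩
      exact ⟨@MulEquiv.symm _ _ (groupMul s.1) (groupMul t.1) e⟩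
    · rintro s t u ⟨e⟩ ⟨f⟩
      exact ⟨@MulEquiv.trans _ _ _ (groupMul s.1) (groupMul t.1) (groupMul u.1) e f⟩

theorem IsCyclic.zpowers_eq_of_orderOf_eq {A : Type*} [Group A] [Finite A] [IsCyclic A] {x y : A}
    (h : orderOf x = orderOf y) : Subgroup.zpowers x = Subgroup.zpowers y := by
  classical
  have := Fintype.ofFinite A
  have key : ∀ z : A, orderOf z = orderOf x →
      (Subgroup.zpowers z : Set A).toFinset = ({a | a ^ orderOf x = 1} : Finset A) := by
    intro z hz
    refine Finset.eq_of_subset_of_card_le (fun a ha => ?_) ?_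
    · simp only [Set.mem_toFinset, SetLike.mem_coe] at ha
      simpa [← orderOf_dvd_iff_pow_eq_one, ← hz] using orderOf_dvd_of_mem_zpowers ha
    · rw [Set.toFinset_card, ← Nat.card_eq_fintype_card]
      exact (IsCyclic.card_pow_eq_one_le (orderOf_pos x)).trans
        (by simpa using (Nat.card_zpowers z).trans hz |>.ge)
  have := (key x rfl).trans (key y h.symm).symm
  exact SetLike.coe_injective (Set.toFinset_inj.1 this)

/-- Two homomorphisms from a finite cyclic group to a finite cyclic group whose images have the
same size differ by an automorphism of the source. -/
theorem IsCyclic.exists_mulEquiv_comp_eq {K A : Type*} [CommGroup K] [Finite K] [IsCyclic K]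
    [Group A] [Finite A] [IsCyclic A] (f₁ f₂ : K →* A)
    (h : Nat.card f₁.range = Nat.card f₂.range) :
    ∃ σ : K ≃* K, ∀ k, f₂ k = f₁ (σ k) := by
  obtain ⟨g, hg⟩ := IsCyclic.exists_generator (α := K)
  have hr : ∀ f : K →* A, f.range = Subgroup.zpowers (f g) := fun f => by
    rw [← MonoidHom.map_zpowers, MonoidHom.range_eq_map, (Subgroup.eq_top_iff' _).2 hg]
  rw [hr, hr, Nat.card_zpowers, Nat.card_zpowers] at h
  have hmem : f₂ g ∈ Subgroup.zpowers (f₁ g) := by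
    rw [zpowers_eq_of_orderOf_eq h]; exact Subgroup.mem_zpowers _
  obtain ⟨a, ha : f₁ g ^ a = f₂ g⟩ := mem_powers_iff_mem_zpowers.2 hmem
  have hcop : a.Coprime (orderOf (f₁ g)) := by
    have h1 := orderOf_pow (n := a) (f₁ g)
    rw [ha, ← h] at h1
    have h2 := Nat.div_mul_cancel (Nat.gcd_dvd_left (orderOf (f₁ g)) a)
    rw [← h1] at h2
    exact Nat.Coprime.symm (Nat.eq_of_mul_eq_mul_left (orderOf_pos (f₁ g)) (by simpa using h2))
  have hdvd : orderOf (f₁ g) ∣ Nat.card K := by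
    rw [← orderOf_eq_card_of_forall_mem_zpowers hg]; exact orderOf_map_dvd f₁ g
  have : NeZero (Nat.card K) := ⟨Nat.card_pos.ne'⟩
  obtain ⟨u, hu⟩ := ZMod.unitsMap_surjective hdvd (ZMod.unitOfCoprime a hcop)
  have hu' : (u.val.val : ZMod (orderOf (f₁ g))) = a := by
    have := congrArg Units.val hu
    simpa [ZMod.unitsMap_val] using this
  refine ⟨{ powCoprime (ZMod.val_coe_unit_coprime u).symm with
    map_mul' := fun x y => mul_pow x y _ }, fun k => ?_⟩
  obtain ⟨b, rfl⟩ := mem_powers_iff_mem_zpowers.2 (hg k)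
  change f₂ (g ^ b) = f₁ ((g ^ b) ^ u.val.val)
  rw [map_pow, map_pow, map_pow, ← ha, ← pow_mul, ← pow_mul, mul_comm b, pow_mul, pow_mul]
  congr 1
  exact (pow_eq_pow_iff_modEq.2 ((ZMod.natCast_eq_natCast_iff _ _ _).1 hu')).symm

theorem SemidirectProduct.index_centralizer_range_inl {N K : Type*} [CommGroup N] [Group K]
    (φ : K →* MulAut N) :
    (Subgroup.centralizer ((inl : N →* N ⋊[φ] K).range : Set (N ⋊[φ] K))).index =
      Nat.card φ.range := by
  have h : (Subgroup.centralizer ((inl : N →* N ⋊[φ] K).range : Set (N ⋊[φ] K))) =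
      (φ.comp rightHom).ker := by
    ext g
    simp only [Subgroup.mem_centralizer_iff, MonoidHom.mem_ker, MonoidHom.comp_apply,
      MonoidHom.coe_range, Set.forall_mem_range, MulEquiv.ext_iff, MulAut.one_apply]
    refine forall_congr' fun x => ?_
    rw [SemidirectProduct.ext_iff]
    simp [mul_comm x, eq_comm]
  rw [h, Subgroup.index_ker, MonoidHom.range_comp,
    MonoidHom.range_eq_top.2 rightHom_surjective, ← MonoidHom.range_eq_map]

theorem SemidirectProduct.commutator_le_range_inl_s12 {N K : Type*} [Group N] [CommGroup K]
    (φ : K →* MulAut N) : commutator (N ⋊[φ] K) ≤ (inl : N →* N ⋊[φ] K).range := by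
  rw [range_inl_eq_ker_rightHom]
  exact Abelianization.commutator_subset_ker _

theorem SemidirectProduct.card_range_inl {N K : Type*} [Group N] [Group K]
    (φ : K →* MulAut N) : Nat.card (inl : N →* N ⋊[φ] K).range = Nat.card N :=
  (Nat.card_congr (MonoidHom.ofInjective inl_injective).toEquiv).symm

theorem SemidirectProduct.commutator_eq_range_inl {N K : Type*} [Group N] [Finite N] [CommGroup K]
    {φ : K →* MulAut N} (h : Nat.card (commutator (N ⋊[φ] K)) = Nat.card N) :
    commutator (N ⋊[φ] K) = (inl : N →* N ⋊[φ] K).range := by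
  have : Finite (inl : N →* N ⋊[φ] K).range :=
    Finite.of_surjective _ (MonoidHom.rangeRestrict_surjective inl)
  exact Subgroup.eq_of_le_of_card_ge (commutator_le_range_inl_s12 φ) (by rw [h, card_range_inl])

/-- The order of the commutator subgroup, and the index of its centralizer. -/
noncomputable def commutatorInvariant (G : Type*) [Group G] : Σ _ : ℕ, ℕ :=
  ⟨Nat.card (commutator G), (Subgroup.centralizer (commutator G : Set G)).index⟩

theorem MulEquiv.map_commutator {G H : Type*} [Group G] [Group H] (e : G ≃* H) :
    (commutator G).map e.toMonoidHom = commutator H := by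
  rw [map_commutator_eq, MonoidHom.range_eq_top.2 e.surjective, commutator_def]

theorem MulEquiv.map_centralizer {G H : Type*} [Group G] [Group H] (e : G ≃* H) (s : Set G) :
    (Subgroup.centralizer s).map e.toMonoidHom = Subgroup.centralizer (e '' s) := by
  ext x
  obtain ⟨x, rfl⟩ := e.surjective x
  simp [Subgroup.mem_centralizer_iff, ← map_mul]

theorem commutatorInvariant_congr {G H : Type*} [Group G] [Group H] (e : G ≃* H) :
    commutatorInvariant G = commutatorInvariant H := by
  have h1 : Nat.card (commutator G) = Nat.card (commutator H) := by
    rw [← e.map_commutator]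
    exact Nat.card_congr ((commutator G).equivMapOfInjective _ e.injective).toEquiv
  have h2 : (Subgroup.centralizer (commutator G : Set G)).index =
      (Subgroup.centralizer (commutator H : Set H)).index := by
    rw [← e.map_commutator, Subgroup.coe_map]
    exact ((Subgroup.index_map_equiv _ e).symm).trans
      (congrArg _ (e.map_centralizer _))
  simp only [commutatorInvariant, h1, h2]

/-- A finite Z-group is a semidirect product of its commutator subgroup by a cyclic group. -/
theorem IsZGroup.exists_mulEquiv_semidirectProduct {G : Type*} [Group G] [Finite G] [IsZGroup G]
    {c m : ℕ} (hc : Nat.card (commutator G) = c) (hm : (commutator G).index = m) :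
    ∃ φ : Multiplicative (ZMod m) →* MulAut (Multiplicative (ZMod c)),
      Nonempty (G ≃* Multiplicative (ZMod c) ⋊[φ] Multiplicative (ZMod m)) := by
  obtain ⟨K, hK⟩ := Subgroup.exists_right_complement'_of_coprime
    (IsZGroup.coprime_commutator_index G)
  have e : Abelianization G ≃* K := hK.symm.QuotientMulEquiv
  have : IsCyclic K := isCyclic_of_surjective e e.surjective
  have hKm : Nat.card K = m := by rw [← hm]; exact (Nat.card_congr e.toEquiv).symm
  have := IsZGroup.isCyclic_commutator G
  have hcard (k : ℕ) : Nat.card (Multiplicative (ZMod k)) = k := Nat.card_zmod k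
  exact ⟨_, ⟨(SemidirectProduct.mulEquivSubgroup hK).symm.trans (SemidirectProduct.congr'
    (mulEquivOfCyclicCardEq (hc.trans (hcard c).symm))
    (mulEquivOfCyclicCardEq (hKm.trans (hcard m).symm)))⟩⟩

theorem commutatorInvariant_snd_eq_card_range {G N K : Type*} [Group G] [CommGroup N] [Finite N]
    [CommGroup K] {φ : K →* MulAut N} (e : G ≃* N ⋊[φ] K)
    (h : Nat.card (commutator G) = Nat.card N) :
    (commutatorInvariant G).2 = Nat.card φ.range := by
  have he := commutatorInvariant_congr e
  rw [← SemidirectProduct.index_centralizer_range_inl,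
    ← SemidirectProduct.commutator_eq_range_inl ((congrArg Sigma.fst he).symm.trans h), he]
  rfl

theorem IsZGroup.nonempty_mulEquiv {G H : Type*} [Group G] [Finite G] [IsZGroup G]
    [Group H] [Finite H] [IsZGroup H] (hcard : Nat.card G = Nat.card H)
    (hinv : commutatorInvariant G = commutatorInvariant H)
    (hcyc : IsCyclic (MulAut (Multiplicative (ZMod (Nat.card (commutator G)))))) :
    Nonempty (G ≃* H) := by
  have hc : Nat.card (commutator H) = Nat.card (commutator G) := (congrArg Sigma.fst hinv).symm
  have hm : (commutator H).index = (commutator G).index := by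
    have h1 := (commutator G).card_mul_index
    rw [hcard, ← (commutator H).card_mul_index, hc] at h1
    exact (Nat.eq_of_mul_eq_mul_left Nat.card_pos h1).symm
  obtain ⟨φ, ⟨e⟩⟩ := exists_mulEquiv_semidirectProduct (G := G) rfl rfl
  obtain ⟨ψ, ⟨f⟩⟩ := exists_mulEquiv_semidirectProduct hc hm
  have : NeZero (Nat.card (commutator G)) := ⟨Nat.card_pos.ne'⟩
  have : NeZero (commutator G).index := ⟨Subgroup.index_ne_zero_of_finite⟩
  have : Finite (MulAut (Multiplicative (ZMod (Nat.card (commutator G))))) :=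
    Finite.of_injective (fun e => (e : _ → _)) DFunLike.coe_injective
  obtain ⟨σ, hσ⟩ := IsCyclic.exists_mulEquiv_comp_eq φ ψ
    ((commutatorInvariant_snd_eq_card_range e (Nat.card_zmod _).symm).symm.trans
      ((congrArg Sigma.snd hinv).trans
        (commutatorInvariant_snd_eq_card_range f (hc.trans (Nat.card_zmod _).symm))))
  exact ⟨e.trans ((SemidirectProduct.congr (MulEquiv.refl _) σ
    (fun k => by ext; simp [hσ])).symm.trans f.symm)⟩

theorem isCyclic_mulAut_zmod_of_prime {p : ℕ} (hp : p.Prime) :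
    IsCyclic (MulAut (Multiplicative (ZMod p))) := by
  have := Fact.mk hp
  have h : Nat.card (Multiplicative (ZMod p)) = p := Nat.card_zmod p
  have : IsCyclic (ZMod (Nat.card (Multiplicative (ZMod p))))ˣ := by rw [h]; infer_instance
  exact (IsCyclic.mulAutMulEquiv (Multiplicative (ZMod p))).isCyclic.2 this

theorem card_mulAut_zmod_of_prime {p : ℕ} (hp : p.Prime) :
    Nat.card (MulAut (Multiplicative (ZMod p))) = p - 1 := by
  have := Fact.mk hp
  have h : Nat.card (Multiplicative (ZMod p)) = p := Nat.card_zmod p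
  rw [IsCyclic.card_mulAut, h, Nat.totient_prime hp]

theorem commutatorInvariant_eq_one {G : Type*} [Group G] (h : commutator G = ⊥) :
    commutatorInvariant G = ⟨1, 1⟩ := by
  simp [commutatorInvariant, h, Subgroup.centralizer_eq_top_iff_subset.2]

theorem commutator_eq_bot_of_index_centralizer_eq_one {G : Type*} [Group G] [Finite G] [IsZGroup G]
    (h : (Subgroup.centralizer (commutator G : Set G)).index = 1) : commutator G = ⊥ := by
  rw [Subgroup.index_eq_one, Subgroup.centralizer_eq_top_iff_subset] at h
  exact (commutator_eq_bot_iff G).2 (MonoidHom.isMulCommutative_of_isCyclic_of_ker_le_center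
    (Abelianization.of (G := G)) (by simpa [Abelianization.ker_of] using h))

theorem exists_semidirectProduct_commutatorInvariant_eq {p m d : ℕ} [NeZero m] (hp : p.Prime)
    (hdm : d ∣ m) (hdp : d ∣ p - 1) (hd : d ≠ 1) :
    ∃ φ : Multiplicative (ZMod m) →* MulAut (Multiplicative (ZMod p)),
      commutatorInvariant (Multiplicative (ZMod p) ⋊[φ] Multiplicative (ZMod m)) = ⟨p, d⟩ := by
  have := Fact.mk hp
  have := isCyclic_mulAut_zmod_of_prime hp
  have hNp : Nat.card (Multiplicative (ZMod p)) = p := Nat.card_zmod p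
  have hKm : Nat.card (Multiplicative (ZMod m)) = m := Nat.card_zmod m
  obtain ⟨g, hg⟩ := IsCyclic.exists_generator (α := Multiplicative (ZMod m))
  obtain ⟨a, ha⟩ := IsCyclic.exists_ofOrder_eq_natCard
    (α := MulAut (Multiplicative (ZMod p)))
  rw [card_mulAut_zmod_of_prime hp] at ha
  have hp1 : p - 1 ≠ 0 := (Nat.sub_pos_of_lt hp.one_lt).ne'
  have hb : orderOf (a ^ ((p - 1) / d)) = d := by
    rw [orderOf_pow_of_dvd
      (Nat.div_ne_zero_iff_of_dvd hdp |>.2 ⟨hp1, ne_zero_of_dvd_ne_zero hp1 hdp⟩)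
      (by rw [ha]; exact Nat.div_dvd_of_dvd hdp), ha, Nat.div_div_self hdp hp1]
  have hord : orderOf (a ^ ((p - 1) / d)) ∣ orderOf g := by
    rwa [hb, orderOf_eq_card_of_forall_mem_zpowers hg, hKm]
  let φ := monoidHomOfForallMemZpowers hg hord
  have hφ : Nat.card φ.range = d := by
    rw [MonoidHom.range_eq_map, ← (Subgroup.eq_top_iff' _).2 hg, MonoidHom.map_zpowers,
      monoidHomOfForallMemZpowers_apply_gen, Nat.card_zpowers, hb]
  have hcard : Nat.card (commutator (Multiplicative (ZMod p) ⋊[φ] Multiplicative (ZMod m))) = p := by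
    have h := Subgroup.card_dvd_of_le (SemidirectProduct.commutator_le_range_inl_s12 φ)
    rw [SemidirectProduct.card_range_inl, hNp] at h
    refine ((Nat.dvd_prime hp).1 h).resolve_left fun h1 => hd ?_
    have h2 := (commutator_eq_bot_iff _).1 (Subgroup.eq_bot_of_card_eq _ h1)
    rw [← hφ, ← SemidirectProduct.index_centralizer_range_inl, Subgroup.index_eq_one,
      Subgroup.centralizer_eq_top_iff_subset]
    intro x _
    exact Subgroup.mem_center_iff.2 fun y => h2.is_comm.comm y x
  refine ⟨φ, Sigma.ext hcard (heq_of_eq ?_)⟩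
  rw [← hφ]
  exact commutatorInvariant_snd_eq_card_range (MulEquiv.refl _) (hcard.trans hNp.symm)

/-- The possible values of `commutatorInvariant` on groups of order `n` whose commutator subgroup
has prime-power order. -/
def commutatorInvariantValues (n : ℕ) : Finset (Σ _ : ℕ, ℕ) :=
  insert ⟨1, 1⟩ (n.primeFactors.sigma fun p => (n.gcd (p - 1)).divisors.erase 1)

theorem Nat.card_divisors_of_squarefree {n : ℕ} (hn : Squarefree n) :
    n.divisors.card = 2 ^ n.primeFactors.card := by
  rw [Nat.card_divisors hn.ne_zero, Finset.prod_congr rfl (g := fun _ => 2), Finset.prod_const]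
  intro p hp
  rw [Nat.factorization_eq_one_of_squarefree hn (Nat.prime_of_mem_primeFactors hp)
    (Nat.dvd_of_mem_primeFactors hp)]

theorem card_commutatorInvariantValues {n : ℕ} (hn : Squarefree n) :
    (commutatorInvariantValues n).card =
      1 + ∑ p ∈ n.primeFactors, (2 ^ (n.primeFactors.filter (fun q => q ∣ p - 1)).card - 1) := by
  rw [commutatorInvariantValues, Finset.card_insert_of_notMem, Finset.card_sigma, add_comm]
  · congr 1
    refine Finset.sum_congr rfl fun p hp => ?_
    have hp1 : p - 1 ≠ 0 :=
      (Nat.sub_pos_of_lt (Nat.prime_of_mem_primeFactors hp).one_lt).ne'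
    have hgcd : Squarefree (n.gcd (p - 1)) := hn.squarefree_of_dvd (Nat.gcd_dvd_left _ _)
    rw [Finset.card_erase_of_mem (Nat.one_mem_divisors.2 hgcd.ne_zero),
      Nat.card_divisors_of_squarefree hgcd, Nat.primeFactors_gcd hn.ne_zero hp1]
    congr 3
    ext q
    simp only [Finset.mem_inter, Finset.mem_filter, Nat.mem_primeFactors]
    tauto
  · simp

theorem commutatorInvariant_mem_values {G : Type*} [Group G] {n : ℕ} (hn : Squarefree n)
    (hG : Nat.card G = n) {u k : ℕ} (hu : u.Prime) (hk : Nat.card (commutator G) = u ^ k) :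
    commutatorInvariant G ∈ commutatorInvariantValues n := by
  have : Finite G := Nat.finite_of_card_ne_zero (hG ▸ hn.ne_zero)
  have : IsZGroup G := IsZGroup.of_squarefree (hG ▸ hn)
  rw [commutatorInvariantValues, Finset.mem_insert]
  by_cases hbot : commutator G = ⊥
  · exact .inl (commutatorInvariant_eq_one hbot)
  have hdvd : u ^ k ∣ n := by rw [← hk, ← hG]; exact Subgroup.card_subgroup_dvd_card _
  have hk0 : k ≠ 0 := fun h => hbot (Subgroup.eq_bot_of_card_eq _ (by simp [hk, h]))
  have hk1 : k = 1 := ((Nat.squarefree_pow_iff hu.ne_one hk0).1 (hn.squarefree_of_dvd hdvd)).2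
  rw [hk1, pow_one] at hk hdvd
  refine .inr (Finset.mem_sigma.2 ⟨?_, Finset.mem_erase.2 ⟨fun h =>
    hbot (commutator_eq_bot_of_index_centralizer_eq_one h), Nat.mem_divisors.2
      ⟨Nat.dvd_gcd ?_ ?_, Nat.gcd_ne_zero_left hn.ne_zero⟩⟩⟩)
  · change Nat.card (commutator G) ∈ _
    exact hk ▸ Nat.mem_primeFactors.2 ⟨hu, hdvd, hn.ne_zero⟩
  · exact hG ▸ Subgroup.index_dvd_card _
  · have : NeZero u := ⟨hu.ne_zero⟩
    obtain ⟨φ, ⟨e⟩⟩ := IsZGroup.exists_mulEquiv_semidirectProduct hk rfl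
    rw [commutatorInvariant_snd_eq_card_range e (hk.trans (Nat.card_zmod u).symm)]
    change _ ∣ Nat.card (commutator G) - 1
    rw [hk, ← card_mulAut_zmod_of_prime hu]
    exact Subgroup.card_subgroup_dvd_card _

theorem exists_commutatorInvariant_eq {n : ℕ} (hn : Squarefree n) {v : Σ _ : ℕ, ℕ}
    (hv : v ∈ commutatorInvariantValues n) :
    ∃ (G : Type) (_ : Group G), Nat.card G = n ∧ commutatorInvariant G = v ∧
      ∃ u k : ℕ, u.Prime ∧ v.1 = u ^ k := by
  obtain ⟨p, d⟩ := v
  rw [commutatorInvariantValues, Finset.mem_insert, Finset.mem_sigma] at hv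
  obtain hv | ⟨hp, hd⟩ := hv
  · rw [hv]
    refine ⟨Multiplicative (ZMod n), inferInstance, Nat.card_zmod n, ?_, 2, 0, Nat.prime_two, rfl⟩
    exact commutatorInvariant_eq_one ((commutator_eq_bot_iff _).2 inferInstance)
  · replace ⟨hp, hpn, _⟩ := Nat.mem_primeFactors.1 hp
    obtain ⟨m, rfl⟩ := hpn
    rw [Finset.mem_erase, Nat.mem_divisors, Nat.dvd_gcd_iff] at hd
    obtain ⟨hd1, ⟨hdn, hdp⟩, -⟩ := hd
    dsimp only at hdn hdp hp
    have : NeZero m := ⟨right_ne_zero_of_mul hn.ne_zero⟩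
    have hcop : d.Coprime p := Nat.Coprime.coprime_dvd_left hdp
      ((Nat.coprime_self_sub_left hp.one_le).2 (Nat.coprime_one_left p))
    obtain ⟨φ, hφ⟩ := exists_semidirectProduct_commutatorInvariant_eq hp
      (hcop.dvd_of_dvd_mul_left hdn) hdp hd1
    refine ⟨_, _, ?_, hφ, p, 1, hp, (pow_one p).symm⟩
    rw [SemidirectProduct.card]
    exact congrArg₂ _ (Nat.card_zmod p) (Nat.card_zmod m)

theorem isCyclic_mulAut_of_mem_values {n : ℕ} {v : Σ _ : ℕ, ℕ}
    (hv : v ∈ commutatorInvariantValues n) : IsCyclic (MulAut (Multiplicative (ZMod v.1))) := by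
  rw [commutatorInvariantValues, Finset.mem_insert, Finset.mem_sigma] at hv
  obtain rfl | ⟨hp, -⟩ := hv
  · have : Subsingleton (Multiplicative (ZMod 1)) := inferInstanceAs (Subsingleton (ZMod 1))
    have : Subsingleton (MulAut (Multiplicative (ZMod 1))) :=
      ⟨fun f g => MulEquiv.ext fun x => Subsingleton.elim _ _⟩
    exact isCyclic_of_subsingleton
  · exact isCyclic_mulAut_zmod_of_prime (Nat.prime_of_mem_primeFactors hp)

/-- Let `n` be a square-free natural number.  The number of isomorphism classes of
groups of order `n` whose commutator subgroup has prime-power order equals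
`1 + Σ_{p ∈ π(n)} (2 ^ c̄_n(p) - 1)`, where `π(n)` is the set of primes dividing `n`
and `c̄_n(p)` is the number of primes `q` dividing `n` with `q ∣ p - 1`. -/
theorem stmt_12 {n : ℕ} (hn : Squarefree n) :
    Nat.card (Quotient (isoSetoid (fun s : Group (Fin n) =>
      letI := s
      ∃ u k : ℕ, u.Prime ∧ Nat.card ↥(commutator (Fin n)) = u ^ k))) =
    1 + ∑ p ∈ n.primeFactors, (2 ^ (n.primeFactors.filter (fun q => q ∣ p - 1)).card - 1) := by
  set P : Group (Fin n) → Prop := fun s => letI := s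
    ∃ u k : ℕ, u.Prime ∧ Nat.card ↥(commutator (Fin n)) = u ^ k
  let F : Quotient (isoSetoid P) → commutatorInvariantValues n :=
    Quotient.lift (fun s => ⟨@commutatorInvariant (Fin n) s.1, by
        obtain ⟨s, u, k, hu, hk⟩ := s
        exact @commutatorInvariant_mem_values (Fin n) s n hn (Nat.card_fin n) u k hu hk⟩)
      fun s t ⟨e⟩ => Subtype.ext (@commutatorInvariant_congr _ _ s.1 t.1 e)
  have hF : Function.Bijective F := by
    constructor
    · rintro ⟨s, hs⟩ ⟨t, ht⟩ h
      obtain ⟨u, k, hu, hk⟩ := hs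
      have hst : @commutatorInvariant (Fin n) s = @commutatorInvariant (Fin n) t :=
        congrArg Subtype.val h
      have hcard : Squarefree (Nat.card (Fin n)) := by rwa [Nat.card_fin]
      have hsz := @IsZGroup.of_squarefree (Fin n) s hcard
      have htz := @IsZGroup.of_squarefree (Fin n) t hcard
      have hcyc : IsCyclic (MulAut (Multiplicative
          (ZMod (@commutatorInvariant (Fin n) s).1))) :=
        isCyclic_mulAut_of_mem_values (@commutatorInvariant_mem_values (Fin n) s n hn
          (Nat.card_fin n) u k hu hk)
      exact Quotient.sound (@IsZGroup.nonempty_mulEquiv (Fin n) (Fin n) s _ hsz t _ htz rfl hst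
        hcyc)
    · rintro ⟨v, hv⟩
      obtain ⟨G, hG, hcard, hinv, u, k, hu, hk⟩ := exists_commutatorInvariant_eq hn hv
      have : Finite G := Nat.finite_of_card_ne_zero (hcard ▸ hn.ne_zero)
      let e : Fin n ≃ G := (Finite.equivFinOfCardEq hcard).symm
      let s : Group (Fin n) := e.group
      have hs : @commutatorInvariant (Fin n) s = v :=
        (@commutatorInvariant_congr (Fin n) G s hG (@Equiv.mulEquiv _ _ e hG.toMul)).trans hinv
      exact ⟨Quotient.mk _ ⟨s, u, k, hu, (congrArg Sigma.fst hs).trans hk⟩, Subtype.ext hs⟩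
  rw [Nat.card_eq_of_bijective F hF, Nat.card_eq_fintype_card, Fintype.card_coe,
    card_commutatorInvariantValues hn]
end

section
/- Let q < r be distinct primes and let H be a finite group generated by an element x of order q and an element y of order r. If 2·|H| ≤ q^2·r, then |H| = q·r and H is metacyclic: H has a normal cyclic subgroup of order r whose quotient is cyclic of order q. -/
/-- If `n ≡ 1 [MOD m]` divides `p * k` with `p` prime and `k < m`, then `n` is `1` or a
multiple `p * c` with `c ≤ k`. -/
theorem eq_one_or_eq_mul_of_modEq_one {p m k n : ℕ} (hp : p.Prime) (hk : 0 < k) (hkm : k < m)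
    (hn : n ∣ p * k) (hmod : n ≡ 1 [MOD m]) :
    n = 1 ∨ ∃ c, 0 < c ∧ c ≤ k ∧ n = p * c := by
  rcases (Nat.coprime_or_dvd_of_prime hp n) with h | ⟨c, rfl⟩
  · left
    have hle : n ≤ k := Nat.le_of_dvd hk (h.symm.dvd_of_dvd_mul_left hn)
    have hn0 : 0 < n := Nat.pos_of_dvd_of_pos hn (Nat.mul_pos hp.pos hk)
    exact hmod.eq_of_lt_of_lt (by omega) (by omega)
  · right
    have hc : c ∣ k := Nat.dvd_of_mul_dvd_mul_left hp.pos hn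
    exact ⟨c, Nat.pos_of_dvd_of_pos hc hk, Nat.le_of_dvd hk hc, rfl⟩

/-- Two positive multiples of coprime numbers, each small and congruent to `1` modulo the other
number, cannot exist. -/
theorem false_of_mul_modEq_one {q r a b k : ℕ} (hqr : q < r) (hq : 1 < q) (hco : q.Coprime r)
    (hk : 2 * k ≤ q) (ha : 0 < a) (hak : a ≤ k) (hbk : b ≤ k)
    (h₁ : q * a ≡ 1 [MOD r]) (h₂ : r * b ≡ 1 [MOD q]) : False := by
  have hmod : q * a + r * b ≡ 1 [MOD q * r] := by
    refine (Nat.modEq_and_modEq_iff_modEq_mul hco).1 ⟨?_, ?_⟩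
    · simpa [Nat.ModEq] using h₂
    · simpa [Nat.ModEq] using h₁
  have hlt : q * a + r * b < q * r := by
    have h₃ : q * a < r * a := Nat.mul_lt_mul_of_pos_right hqr ha
    have h₄ : r * (2 * k) ≤ r * q := Nat.mul_le_mul_left r hk
    have h₅ : r * a ≤ r * k := Nat.mul_le_mul_left r hak
    have h₆ : r * b ≤ r * k := Nat.mul_le_mul_left r hbk
    linarith [Nat.mul_comm q r]
  have heq := hmod.eq_of_lt_of_lt hlt (by nlinarith)
  have : q ≤ q * a := Nat.le_mul_of_pos_right q ha
  omega

/-- If `a` and `b` generate `H` and `⟨a⟩` is normal, then `|H|` divides the product of the orders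
of `a` and `b`. -/
theorem card_dvd_orderOf_mul_orderOf {H : Type*} [Group H] {a b : H}
    (hgen : Subgroup.closure {a, b} = ⊤) (hN : (Subgroup.zpowers a).Normal) :
    Nat.card H ∣ orderOf a * orderOf b := by
  have htop : Subgroup.zpowers (b : H ⧸ Subgroup.zpowers a) = ⊤ := by
    have h := Subgroup.map_top_of_surjective _
      (QuotientGroup.mk'_surjective (Subgroup.zpowers a))
    have ha : (a : H ⧸ Subgroup.zpowers a) = 1 :=
      (QuotientGroup.eq_one_iff a).2 (Subgroup.mem_zpowers a)
    rw [← hgen, MonoidHom.map_closure, Set.image_pair] at h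
    simpa [ha, ← Subgroup.zpowers_eq_closure] using h
  rw [Subgroup.card_eq_card_quotient_mul_card_subgroup (Subgroup.zpowers a), Nat.card_zpowers,
    mul_comm, ← Subgroup.card_top (G := H ⧸ Subgroup.zpowers a), ← htop, Nat.card_zpowers]
  exact Nat.mul_dvd_mul_left _ (orderOf_map_dvd (QuotientGroup.mk' (Subgroup.zpowers a)) b)

/-- If `|H| = p * m` with `p ∤ m` prime and `a` has order `p`, then `⟨a⟩` is a Sylow subgroup, so
the number of its conjugates divides `m`, is `1` modulo `p`, and is `1` only if `⟨a⟩` is normal. -/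
theorem exists_card_sylow_zpowers {H : Type*} [Group H] [Finite H] {p m : ℕ} (hp : p.Prime)
    {a : H} (ha : orderOf a = p) (hcard : Nat.card H = p * m) (hm : ¬ p ∣ m) :
    ∃ n, n ∣ m ∧ n ≡ 1 [MOD p] ∧ (n = 1 → (Subgroup.zpowers a).Normal) := by
  have : Fact p.Prime := ⟨hp⟩
  have hindex : (Subgroup.zpowers a).index = m := by
    have h := (Subgroup.zpowers a).card_mul_index
    rw [Nat.card_zpowers, ha, hcard] at h
    exact Nat.eq_of_mul_eq_mul_left hp.pos h
  have hgroup : IsPGroup p (Subgroup.zpowers a) :=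
    IsPGroup.of_card (n := 1) (by rw [Nat.card_zpowers, ha, pow_one])
  let P : Sylow p H := hgroup.toSylow (by rwa [hindex])
  refine ⟨Nat.card (Sylow p H), hindex ▸ P.card_dvd_index, card_sylow_modEq_one p H, fun h ↦ ?_⟩
  have : Subsingleton (Sylow p H) := (Nat.card_eq_one_iff_unique.1 h).1
  exact P.normal_of_subsingleton

/-- Let `q < r` be distinct primes and `H` a finite group generated by an element `x`
of order `q` and an element `y` of order `r`.  If `2 * |H| ≤ q^2 * r`, then
`|H| = q * r` and `H` is metacyclic: it has a normal cyclic subgroup of order `r`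
whose quotient is cyclic of order `q`. -/
theorem stmt_13 {H : Type*} [Group H] [Finite H] {q r : ℕ} (hq : q.Prime) (hr : r.Prime)
    (hqr : q < r) (x y : H) (hx : orderOf x = q) (hy : orderOf y = r)
    (hgen : Subgroup.closure {x, y} = ⊤) (hcard : 2 * Nat.card H ≤ q ^ 2 * r) :
    Nat.card H = q * r ∧
    ∃ (N : Subgroup H) (hN : N.Normal), IsCyclic ↥N ∧ Nat.card ↥N = r ∧
      Nat.card (H ⧸ N) = q ∧ (letI := hN; IsCyclic (H ⧸ N)) := by
  have hco : q.Coprime r := (Nat.coprime_primes hq hr).2 hqr.ne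
  obtain ⟨k, hk⟩ : q * r ∣ Nat.card H :=
    hco.mul_dvd_of_dvd_of_dvd (hx ▸ orderOf_dvd_natCard x) (hy ▸ orderOf_dvd_natCard y)
  have hk0 : 0 < k := Nat.pos_of_ne_zero fun h ↦ Nat.card_pos.ne' (by rw [hk, h, mul_zero])
  have hkq : 2 * k ≤ q := by
    refine Nat.le_of_mul_le_mul_left (c := q * r) ?_ (Nat.mul_pos hq.pos hr.pos)
    calc q * r * (2 * k) = 2 * (q * r * k) := by ring
      _ ≤ q ^ 2 * r := hk ▸ hcard
      _ = q * r * q := by ring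
  have hqk : ¬ q ∣ r * k := fun h ↦
    Nat.not_dvd_of_pos_of_lt hk0 (by omega) (hco.dvd_of_dvd_mul_left h)
  have hrk : ¬ r ∣ q * k := fun h ↦
    Nat.not_dvd_of_pos_of_lt hk0 (by omega) (hco.symm.dvd_of_dvd_mul_left h)
  obtain ⟨m, hm, hm₁, hmN⟩ := exists_card_sylow_zpowers hq hx (hk.trans (mul_assoc q r k)) hqk
  obtain ⟨n, hn, hn₁, hnN⟩ := exists_card_sylow_zpowers hr hy
    (hk.trans (by ring : q * r * k = r * (q * k))) hrk
  have card_eq (h : Nat.card H ∣ q * r) : Nat.card H = q * r :=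
    Nat.dvd_antisymm h ⟨k, hk⟩
  have hN : (Subgroup.zpowers y).Normal := by
    rcases eq_one_or_eq_mul_of_modEq_one hq hk0 (by omega) hn hn₁ with h | ⟨c, hc, hck, rfl⟩
    · exact hnN h
    rcases eq_one_or_eq_mul_of_modEq_one hr hk0 (by omega) hm hm₁ with h | ⟨d, -, hdk, rfl⟩
    · have hkone : k = 1 := by
        have h' := card_eq (hx ▸ hy ▸ card_dvd_orderOf_mul_orderOf hgen (hmN h))
        rw [hk] at h'
        exact (Nat.mul_eq_left (Nat.mul_pos hq.pos hr.pos).ne').1 h'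
      obtain rfl : c = 1 := by omega
      rw [mul_one] at hn₁
      exact absurd (hn₁.eq_of_lt_of_lt hqr hr.one_lt) hq.one_lt.ne'
    · exact (false_of_mul_modEq_one hqr hq.one_lt hco hkq hc hck hdk hn₁ hm₁).elim
  have hH : Nat.card H = q * r := by
    refine card_eq ?_
    have h := card_dvd_orderOf_mul_orderOf (Set.pair_comm x y ▸ hgen) hN
    rwa [hx, hy, mul_comm] at h
  have hNcard : Nat.card (Subgroup.zpowers y) = r := by rw [Nat.card_zpowers, hy]
  have hquot : Nat.card (H ⧸ Subgroup.zpowers y) = q := by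
    have h := Subgroup.card_eq_card_quotient_mul_card_subgroup (Subgroup.zpowers y)
    rw [hH, hNcard] at h
    exact (Nat.eq_of_mul_eq_mul_right hr.pos h).symm
  have : Fact q.Prime := ⟨hq⟩
  exact ⟨hH, Subgroup.zpowers y, hN, inferInstance, hNcard, hquot,
    isCyclic_of_prime_card hquot⟩
end

section
/- Let q < r be distinct primes and let H be a finite group generated by an element x of order q and an element y of order r, with 2·|H| ≤ q^2·r. Then H has a normal Sylow q-subgroup or a normal Sylow r-subgroup. -/
theorem eq_one_or_eq_one_of_dvd_of_modEq_one {q r m a b : ℕ} (hq : q.Prime) (hr : r.Prime)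
    (hqr : q < r) (hm : 0 < m) (hmq : 2 * m ≤ q) (ha : a ∣ q * m) (har : a ≡ 1 [MOD r])
    (hb : b ∣ r * m) (hbq : b ≡ 1 [MOD q]) : a = 1 ∨ b = 1 := by
  have one_lt_q := hq.one_lt
  by_cases hqa : q ∣ a
  swap
  · have h := Nat.le_of_dvd hm (((Nat.Prime.coprime_iff_not_dvd hq).2 hqa).symm.dvd_of_dvd_mul_left ha)
    exact Or.inl (har.eq_of_lt_of_lt (by omega) (by omega))
  by_cases hrb : r ∣ b
  swap
  · have h := Nat.le_of_dvd hm (((Nat.Prime.coprime_iff_not_dvd hr).2 hrb).symm.dvd_of_dvd_mul_left hb)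
    exact Or.inr (hbq.eq_of_lt_of_lt (by omega) (by omega))
  exfalso
  obtain ⟨d, rfl⟩ := hqa
  obtain ⟨e, rfl⟩ := hrb
  have hd : d ≤ m := Nat.le_of_dvd hm (Nat.dvd_of_mul_dvd_mul_left hq.pos ha)
  have he : e ≤ m := Nat.le_of_dvd hm (Nat.dvd_of_mul_dvd_mul_left hr.pos hb)
  have he0 : 0 < e := Nat.pos_of_dvd_of_pos (Nat.dvd_of_mul_dvd_mul_left hr.pos hb) hm
  have hd0 : 0 < d := Nat.pos_of_dvd_of_pos (Nat.dvd_of_mul_dvd_mul_left hq.pos ha) hm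
  have hqd : 1 ≤ q * d := Nat.mul_pos hq.pos hd0
  have hre : 1 ≤ r * e := Nat.mul_pos hr.pos he0
  obtain ⟨k, hk⟩ := (Nat.modEq_iff_dvd' hqd).1 har.symm
  obtain ⟨l, hl⟩ := (Nat.modEq_iff_dvd' hre).1 hbq.symm
  have hk' : q * d = r * k + 1 := by omega
  have hl' : r * e = q * l + 1 := by omega
  have hkq : 2 * k < q := by
    by_contra! h
    nlinarith [Nat.mul_le_mul_left r h, Nat.mul_le_mul_left q (show 2 * d ≤ q by omega),
      Nat.mul_le_mul_left q hqr.le]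
  have hdvd : q ∣ r * (e + k) := ⟨l + d, by linarith⟩
  have hek : q ∣ e + k :=
    ((Nat.coprime_primes hq hr).2 hqr.ne).dvd_of_dvd_mul_left hdvd
  have := Nat.le_of_dvd (by omega) hek
  omega

theorem Sylow.card_dvd_of_card_eq_mul {G : Type*} [Group G] [Finite G] {p n : ℕ} (hp : p.Prime)
    (h : Nat.card G = p * n) : Nat.card (Sylow p G) ∣ n := by
  have := Fact.mk hp
  obtain ⟨P⟩ : Nonempty (Sylow p G) := inferInstance
  have hP : (P : Subgroup G).index ∣ p * n := h ▸ (P : Subgroup G).index_dvd_card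
  exact P.card_dvd_index.trans
    (((Nat.Prime.coprime_iff_not_dvd hp).2 P.not_dvd_index).symm.dvd_of_dvd_mul_left hP)

theorem Sylow.exists_normal_of_card_eq_one {G : Type*} [Group G] [Finite G] {p : ℕ}
    (h : Nat.card (Sylow p G) = 1) : ∃ P : Sylow p G, (P : Subgroup G).Normal := by
  have := (Nat.card_eq_one_iff_unique.1 h).1
  obtain ⟨P⟩ : Nonempty (Sylow p G) := inferInstance
  exact ⟨P, P.normal_of_subsingleton⟩


/-- Let `q < r` be distinct primes and `H` a finite group generated by an element `x`
of order `q` and an element `y` of order `r`, with `2 * |H| ≤ q^2 * r`.  Then `H` has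
a normal Sylow `q`-subgroup or a normal Sylow `r`-subgroup. -/
theorem stmt_14 {H : Type*} [Group H] [Finite H] {q r : ℕ} (hq : q.Prime) (hr : r.Prime)
    (hqr : q < r) (x y : H) (hx : orderOf x = q) (hy : orderOf y = r)
    (hgen : Subgroup.closure {x, y} = ⊤) (hcard : 2 * Nat.card H ≤ q ^ 2 * r) :
    (∃ Q : Sylow q H, (Q : Subgroup H).Normal) ∨ (∃ R : Sylow r H, (R : Subgroup H).Normal) := by
  have := Fact.mk hq
  have := Fact.mk hr
  obtain ⟨m, hm⟩ : q * r ∣ Nat.card H :=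
    ((Nat.coprime_primes hq hr).2 hqr.ne).mul_dvd_of_dvd_of_dvd
      (hx ▸ orderOf_dvd_natCard x) (hy ▸ orderOf_dvd_natCard y)
  have hm0 : 0 < m := Nat.pos_of_ne_zero fun h => Nat.card_pos.ne' (hm.trans (by simp [h]))
  have hmq : 2 * m ≤ q :=
    Nat.le_of_mul_le_mul_left (by rw [hm] at hcard; linarith) (Nat.mul_pos hq.pos hr.pos)
  have hR : Nat.card (Sylow r H) ∣ q * m := Sylow.card_dvd_of_card_eq_mul hr (by rw [hm]; ring)
  have hQ : Nat.card (Sylow q H) ∣ r * m := Sylow.card_dvd_of_card_eq_mul hq (by rw [hm]; ring)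
  exact (eq_one_or_eq_one_of_dvd_of_modEq_one hq hr hqr hm0 hmq hR (card_sylow_modEq_one r H)
    hQ (card_sylow_modEq_one q H)).symm.imp
      Sylow.exists_normal_of_card_eq_one Sylow.exists_normal_of_card_eq_one
end

section
/- Let G be a finite group whose commutator subgroup [G,G] is nilpotent, let p and q be distinct primes both dividing the order of [G,G], and let ρ : G → GL(V) be a faithful irreducible representation of G on a nonzero finite-dimensional complex vector space V. Then there exists an element g ∈ [G,G] such that ρ(g) has an eigenvalue λ ∈ ℂ that is a primitive pq-th root of unity (i.e., λ has multiplicative order pq). -/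
open Module Polynomial in
/-- A linear map of finite order invertible in the field is diagonalizable over an algebraically
closed field, so it has a nontrivial eigenvalue unless it is the identity. -/
theorem exists_eigenvector_of_pow_eq_one {K E : Type*} [Field K] [IsAlgClosed K] [AddCommGroup E]
    [Module K E] [FiniteDimensional K E] {T : End K E} {n : ℕ} (hn : (n : K) ≠ 0)
    (hT : T ^ n = 1) (hT1 : T ≠ 1) :
    ∃ (μ : K) (v : E), μ ≠ 1 ∧ v ≠ 0 ∧ T v = μ • v := by
  by_contra! h
  have hss : T.IsSemisimple :=
    End.isSemisimple_of_squarefree_aeval_eq_zero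
      (X_pow_sub_one_separable_iff.mpr hn).squarefree (by simp [hT])
  have htop : T.eigenspace 1 = ⊤ := by
    rw [eq_top_iff, ← hss.iSup_eigenspace_eq_top]
    refine iSup_le fun μ v hv => ?_
    rw [End.mem_eigenspace_iff] at hv ⊢
    by_cases hv0 : v = 0
    · simp [hv0]
    by_cases hμ : μ = 1
    · rwa [← hμ]
    · exact absurd hv (h μ v hμ hv0)
  refine hT1 (LinearMap.ext fun v => ?_)
  have hv : v ∈ T.eigenspace 1 := htop ▸ Submodule.mem_top
  simpa [End.mem_eigenspace_iff] using hv

theorem Module.End.pow_apply_of_apply_eq_smul {R M : Type*} [CommSemiring R] [AddCommMonoid M]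
    [Module R M] {T : Module.End R M} {μ : R} {v : M} (h : T v = μ • v) (n : ℕ) :
    (T ^ n) v = μ ^ n • v := by
  induction n with
  | zero => simp
  | succ n ih => rw [pow_succ', Module.End.mul_apply, ih, map_smul, h, smul_smul, pow_succ]

/-- Some power of an operator of prime power order acting nontrivially on an invariant subspace
has there an eigenvalue of prime order. -/
theorem exists_pow_eigenvector_orderOf_eq_prime {K V : Type*} [Field K] [IsAlgClosed K]
    [CharZero K] [AddCommGroup V] [Module K V] [FiniteDimensional K V] {T : Module.End K V}
    {W : Submodule K V} (hW : ∀ v ∈ W, T v ∈ W) (hne : ∃ v ∈ W, T v ≠ v) {p k : ℕ}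
    (hp : p.Prime) (hT : T ^ p ^ k = 1) :
    ∃ (m : ℕ) (μ : K), ∃ v ∈ W, v ≠ 0 ∧ (T ^ m) v = μ • v ∧ orderOf μ = p := by
  obtain ⟨w, hw, hTw⟩ := hne
  have hres : (T.restrict hW) ^ p ^ k = 1 := by
    rw [Module.End.pow_restrict]
    ext v
    simp [hT]
  obtain ⟨μ, v, hμ, hv, hTv⟩ := exists_eigenvector_of_pow_eq_one
    (Nat.cast_ne_zero.mpr (pow_pos hp.pos k).ne') hres fun h =>
      hTw (congrArg Subtype.val (LinearMap.congr_fun h ⟨w, hw⟩))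
  have hv0 : (v : V) ≠ 0 := by simpa using hv
  have hTv' : T v = μ • (v : V) := congrArg Subtype.val hTv
  have hμk : μ ^ p ^ k = 1 := by
    have h := Module.End.pow_apply_of_apply_eq_smul hTv' (p ^ k)
    rw [hT, Module.End.one_apply] at h
    exact smul_left_injective K hv0 (by simpa using h.symm)
  obtain ⟨j, -, hj⟩ := (Nat.dvd_prime_pow hp).mp (orderOf_dvd_of_pow_eq_one hμk)
  have hj0 : j ≠ 0 := by
    rintro rfl
    exact hμ (orderOf_eq_one_iff.mp (by simpa using hj))
  have hdvd : p ∣ orderOf μ := hj ▸ dvd_pow_self p hj0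
  have hpos : orderOf μ ≠ 0 := hj ▸ (pow_pos hp.pos j).ne'
  exact ⟨orderOf μ / p, μ ^ (orderOf μ / p), v, v.2, hv0,
    Module.End.pow_apply_of_apply_eq_smul hTv' _, orderOf_pow_orderOf_div hpos hdvd⟩

/-- In a faithful irreducible representation, a nontrivial normal subgroup fixes no nonzero
vector. -/
theorem Representation.eq_zero_of_forall_mem_normal {k G V : Type*} [Field k] [Group G]
    [AddCommGroup V] [Module k V] (ρ : Representation k G V) (hfaith : Function.Injective ρ)
    (hirr : ∀ W : Submodule k V, (∀ g : G, ∀ v ∈ W, ρ g v ∈ W) → W = ⊥ ∨ W = ⊤)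
    (H : Subgroup G) [hH : H.Normal] (hne : H ≠ ⊥) {v : V} (hv : ∀ h ∈ H, ρ h v = v) : v = 0 := by
  let W : Submodule k V := ⨅ h : H, LinearMap.ker (ρ h - 1)
  have hmem : ∀ w, w ∈ W ↔ ∀ h ∈ H, ρ h w = w := fun w => by
    simp [W, Submodule.mem_iInf, sub_eq_zero]
  have hinv : ∀ g : G, ∀ w ∈ W, ρ g w ∈ W := fun g w hw => (hmem _).mpr fun h hh => by
    have hconj := (hmem w).mp hw (g⁻¹ * h * g) (by simpa using hH.conj_mem h hh g⁻¹)
    calc ρ h (ρ g w) = ρ g (ρ (g⁻¹ * h * g) w) := by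
          simp only [← Module.End.mul_apply, ← map_mul]
          congr 2
          group
      _ = ρ g w := by rw [hconj]
  rcases hirr W hinv with hbot | htop
  · exact (Submodule.mem_bot k).mp (hbot ▸ (hmem v).mpr hv)
  · refine absurd ((Subgroup.eq_bot_iff_forall H).mpr fun h hh => hfaith ?_) hne
    ext w
    simpa using (hmem w).mp (htop ▸ Submodule.mem_top) h hh

/-- A nilpotent normal subgroup `N` of a finite group contains, for each prime dividing its order,
a nontrivial `p`-subgroup that is normal in the whole group. -/
theorem Subgroup.exists_normal_isPGroup_of_isNilpotent {G : Type*} [Group G] [Finite G]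
    (N : Subgroup G) [N.Normal] [Group.IsNilpotent N] {p : ℕ} (hp : p.Prime)
    (hpd : p ∣ Nat.card N) : ∃ P : Subgroup G, P ≤ N ∧ P.Normal ∧ P ≠ ⊥ ∧ IsPGroup p P := by
  have : Fact p.Prime := ⟨hp⟩
  let P : Sylow p N := default
  have : (P : Subgroup N).Characteristic := P.characteristic_of_normal inferInstance
  refine ⟨(P : Subgroup N).map N.subtype, Subgroup.map_subtype_le _, inferInstance, ?_,
    P.isPGroup'.map _⟩
  rw [Ne, Subgroup.map_eq_bot_iff_of_injective _ N.subtype_injective]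
  exact P.ne_bot_of_dvd_card hpd


/-- Let `G` be a finite group whose commutator subgroup is nilpotent, let `p` and `q`
be distinct primes dividing the order of the commutator subgroup, and let `ρ` be a
faithful irreducible representation of `G` on a nonzero finite-dimensional complex
vector space `V`.  Then some element `g` of the commutator subgroup is such that
`ρ g` has an eigenvalue that is a primitive `pq`-th root of unity (i.e. has
multiplicative order `p * q`). -/
theorem stmt_17 {G : Type*} [Group G] [Finite G] {V : Type*} [AddCommGroup V]
    [Module ℂ V] [FiniteDimensional ℂ V] [Nontrivial V]
    (hnil : Group.IsNilpotent ↥(commutator G))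
    {p q : ℕ} (hp : p.Prime) (hq : q.Prime) (hpq : p ≠ q)
    (hpd : p ∣ Nat.card ↥(commutator G)) (hqd : q ∣ Nat.card ↥(commutator G))
    (ρ : Representation ℂ G V) (hfaith : Function.Injective ρ)
    (hirr : ∀ W : Submodule ℂ V, (∀ g : G, ∀ v ∈ W, ρ g v ∈ W) → W = ⊥ ∨ W = ⊤) :
    ∃ g ∈ commutator G, ∃ (lam : ℂ) (v : V), v ≠ 0 ∧ ρ g v = lam • v ∧
      orderOf lam = p * q := by
  obtain ⟨P, hPN, hPn, hP, hPp⟩ :=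
    (commutator G).exists_normal_isPGroup_of_isNilpotent hp hpd
  obtain ⟨Q, hQN, hQn, hQ, hQq⟩ :=
    (commutator G).exists_normal_isPGroup_of_isNilpotent hq hqd
  have : Fact p.Prime := ⟨hp⟩
  have : Fact q.Prime := ⟨hq⟩
  have hcomm : ∀ x ∈ P, ∀ y ∈ Q, Commute x y := fun x hx y hy =>
    Subgroup.commute_of_normal_of_disjoint P Q hPn hQn
      (IsPGroup.disjoint_of_ne p q hpq P Q hPp hQq) x y hx hy
  have hpow : ∀ {r : ℕ} {R : Subgroup G}, IsPGroup r R → ∀ x ∈ R, ∃ k, ρ x ^ r ^ k = 1 := by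
    intro r R hR x hx
    obtain ⟨k, hk⟩ := hR ⟨x, hx⟩
    exact ⟨k, by rw [← map_pow, show x ^ r ^ k = 1 from congrArg Subtype.val hk, map_one]⟩
  have hmove : ∀ {R : Subgroup G}, R.Normal → R ≠ ⊥ → ∀ v ≠ 0, ∃ x ∈ R, ρ x v ≠ v := by
    intro R _ hR v hv
    by_contra! h
    exact hv (ρ.eq_zero_of_forall_mem_normal hfaith hirr R hR h)
  obtain ⟨v₀, hv₀⟩ := exists_ne (0 : V)
  obtain ⟨x, hx, hxv⟩ := hmove hPn hP v₀ hv₀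
  obtain ⟨k, hk⟩ := hpow hPp x hx
  obtain ⟨m, lam, u, -, hu, hxu, hlam⟩ := exists_pow_eigenvector_orderOf_eq_prime (W := ⊤)
    (by simp) ⟨v₀, Submodule.mem_top, hxv⟩ hp hk
  obtain ⟨y, hy, hyu⟩ := hmove hQn hQ u hu
  obtain ⟨l, hl⟩ := hpow hQq y hy
  obtain ⟨n, mu, w, hwE, hw, hyw, hmu⟩ := exists_pow_eigenvector_orderOf_eq_prime
    (W := Module.End.eigenspace (ρ x ^ m) lam)
    (Module.End.mapsTo_genEigenspace_of_comm
      (((hcomm x hx y hy).map ρ).pow_left m) lam 1)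
    ⟨u, Module.End.mem_eigenspace_iff.mpr hxu, hyu⟩ hq hl
  rw [Module.End.mem_eigenspace_iff] at hwE
  refine ⟨x ^ m * y ^ n, mul_mem (pow_mem (hPN hx) m) (pow_mem (hQN hy) n), lam * mu, w, hw, ?_, ?_⟩
  · rw [map_mul, map_pow, map_pow, Module.End.mul_apply, hyw, map_smul, hwE, smul_smul, mul_comm]
  · rw [(Commute.all lam mu).orderOf_mul_eq_mul_orderOf_of_coprime, hlam, hmu]
    rw [hlam, hmu]
    exact (Nat.coprime_primes hp hq).mpr hpq
end

section
/- Let p ≠ q be primes and let G be a finite group such that: the commutator subgroup N = [G,G] is abelian and is a Sylow q-subgroup of G; the quotient G/N is cyclic of order p^h for some h ≥ 1; and there is an element z ∈ G generating a Sylow p-subgroup of G such that conjugation by z^p acts trivially on N while conjugation by z fixes no nontrivial element of N. Then every irreducible complex representation of G is of dimension 1 or p, and the one-dimensional representations are exactly those that are trivial on N. -/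
open Module in
/-- A commuting family of endomorphisms of finite order of a nonzero finite-dimensional complex
space has a common eigenvector. -/
theorem Module.End.exists_common_eigenvector_of_pow_eq_one {ι V : Type*} [AddCommGroup V]
    [Module ℂ V] [Nontrivial V] [FiniteDimensional ℂ V] (f : ι → End ℂ V)
    (hcomm : ∀ i j, Commute (f i) (f j)) {m : ℕ} (hm : m ≠ 0) (hf : ∀ i, f i ^ m = 1) :
    ∃ (v : V) (χ : ι → ℂ), v ≠ 0 ∧ ∀ i, f i v = χ i • v := by
  have htop := End.iSup_iInf_maxGenEigenspace_eq_top_of_iSup_maxGenEigenspace_eq_top_of_commute f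
    (fun i j _ => hcomm i j) (fun i => End.iSup_maxGenEigenspace_eq_top (f i))
  obtain ⟨χ, hχ⟩ : ∃ χ : ι → ℂ, ⨅ i, (f i).maxGenEigenspace (χ i) ≠ ⊥ := by
    by_contra! hbot
    simp [hbot] at htop
  obtain ⟨v, hv, hv0⟩ := Submodule.exists_mem_ne_zero_of_ne_bot hχ
  refine ⟨v, χ, hv0, fun i => ?_⟩
  have hss : (f i).IsSemisimple := by
    refine End.isSemisimple_of_squarefree_aeval_eq_zero (p := Polynomial.X ^ m - 1)
      (Polynomial.X_pow_sub_one_separable_iff.mpr (by exact_mod_cast hm)).squarefree ?_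
    simp [hf i]
  have hi := (Submodule.mem_iInf _).mp hv i
  rw [hss.isFinitelySemisimple.maxGenEigenspace_eq_eigenspace] at hi
  exact End.mem_eigenspace_iff.mp hi

open Module in
/-- Common eigenvectors of a commuting family with pairwise distinct systems of eigenvalues are
linearly independent. -/
theorem Module.End.linearIndependent_of_common_eigenvectors {ι κ V : Type*} [AddCommGroup V]
    [Module ℂ V] (f : ι → End ℂ V) (hcomm : ∀ i j, Commute (f i) (f j))
    (χ : κ → ι → ℂ) (hχ : Function.Injective χ) (w : κ → V) (hw0 : ∀ k, w k ≠ 0)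
    (hw : ∀ k i, f i (w k) = χ k i • w k) : LinearIndependent ℂ w := by
  have hind := End.independent_iInf_maxGenEigenspace_of_forall_mapsTo f
    (fun i j _ => End.mapsTo_maxGenEigenspace_of_comm (hcomm j i) _)
  refine (hind.comp hχ).linearIndependent _ (fun k => ?_) hw0
  refine (Submodule.mem_iInf _).mpr fun i => ?_
  exact End.mem_maxGenEigenspace _ _ _ |>.mpr ⟨1, by simp [hw k i]⟩

namespace Representation

variable {G V : Type*} [Group G] [AddCommGroup V] [Module ℂ V] {ρ : Representation ℂ G V}

theorem finiteDimensional_of_irreducible [Finite G] [Nontrivial V]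
    (hirr : ∀ W : Submodule ℂ V, (∀ g : G, ∀ v ∈ W, ρ g v ∈ W) → W = ⊥ ∨ W = ⊤) :
    FiniteDimensional ℂ V := by
  obtain ⟨v, hv⟩ := exists_ne (0 : V)
  have hmem : v ∈ Submodule.span ℂ (Set.range fun g => ρ g v) :=
    Submodule.subset_span ⟨1, by simp⟩
  rcases hirr (Submodule.span ℂ (Set.range fun g => ρ g v)) (fun g w hw => by
    induction hw using Submodule.span_induction with
    | mem x hx =>
      obtain ⟨a, rfl⟩ := hx
      exact Submodule.subset_span ⟨g * a, by simp⟩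
    | zero => simp
    | add x y _ _ hx hy => rw [map_add]; exact Submodule.add_mem _ hx hy
    | smul c x _ hx => rw [map_smul]; exact Submodule.smul_mem _ c hx) with hbot | htop
  · rw [hbot] at hmem
    exact absurd ((Submodule.mem_bot ℂ).mp hmem) hv
  · exact .of_fg_top (htop ▸ Submodule.fg_span (Set.finite_range _))

/-- Schur's lemma: an endomorphism commuting with an irreducible representation is a scalar. -/
theorem exists_scalar_of_irreducible [FiniteDimensional ℂ V] [Nontrivial V]
    (hirr : ∀ W : Submodule ℂ V, (∀ g : G, ∀ v ∈ W, ρ g v ∈ W) → W = ⊥ ∨ W = ⊤)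
    (f : Module.End ℂ V) (hf : ∀ g, Commute f (ρ g)) : ∃ c : ℂ, ∀ v, f v = c • v := by
  obtain ⟨c, hc⟩ := Module.End.exists_eigenvalue f
  refine ⟨c, fun v => ?_⟩
  rcases hirr (f.eigenspace c) (fun g w hw => by
    rw [Module.End.mem_eigenspace_iff] at hw ⊢
    rw [← Module.End.mul_apply, (hf g).eq, Module.End.mul_apply, hw, map_smul]) with hbot | htop
  · exact absurd hbot hc
  · exact Module.End.mem_eigenspace_iff.mp (htop ▸ Submodule.mem_top)

theorem finrank_eq_one_of_irreducible_of_commute [FiniteDimensional ℂ V] [Nontrivial V]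
    (hirr : ∀ W : Submodule ℂ V, (∀ g : G, ∀ v ∈ W, ρ g v ∈ W) → W = ⊥ ∨ W = ⊤)
    (hcomm : ∀ a b, Commute (ρ a) (ρ b)) : Module.finrank ℂ V = 1 := by
  obtain ⟨v, hv⟩ := exists_ne (0 : V)
  rcases hirr (ℂ ∙ v) (fun g w hw => by
    obtain ⟨c, hc⟩ := exists_scalar_of_irreducible hirr (ρ g) (hcomm g)
    rw [hc]
    exact Submodule.smul_mem _ c hw) with hbot | htop
  · exact absurd (Submodule.span_singleton_eq_bot.mp hbot) hv
  · rw [← finrank_top, ← htop, finrank_span_singleton hv]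

theorem eq_id_of_mem_commutator_of_finrank_eq_one (h1 : Module.finrank ℂ V = 1) {n : G}
    (hn : n ∈ commutator G) : ρ n = LinearMap.id := by
  have hscalar (g : G) : ∃ c : ℂ, ρ g = c • LinearMap.id :=
    (LinearMap.existsUnique_eq_smul_id_of_finrank_eq_one h1 (ρ g)).exists
  have hcomm (a b : G) : ρ a * ρ b = ρ b * ρ a := by
    obtain ⟨c, hc⟩ := hscalar a
    obtain ⟨d, hd⟩ := hscalar b
    ext v
    simp [hc, hd, smul_comm c d]
  have hle : commutator G ≤ MonoidHom.ker ρ := by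
    rw [commutator_def, Subgroup.commutator_le]
    intro a _ b _
    rw [MonoidHom.mem_ker, commutatorElement_def, map_mul, map_mul, map_mul, hcomm a b,
      mul_assoc (ρ b), ← map_mul, mul_inv_cancel, map_one, mul_one, ← map_mul, mul_inv_cancel,
      map_one]
  exact MonoidHom.mem_ker.mp (hle hn)

/-- If a nonzero vector of an irreducible representation is fixed by a normal subgroup, then that
subgroup acts trivially. -/
theorem eq_id_of_irreducible_of_fixed_vector {N : Subgroup G} [N.Normal]
    (hirr : ∀ W : Submodule ℂ V, (∀ g : G, ∀ v ∈ W, ρ g v ∈ W) → W = ⊥ ∨ W = ⊤)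
    {v : V} (hv : v ≠ 0) (hfix : ∀ n ∈ N, ρ n v = v) : ∀ n ∈ N, ρ n = LinearMap.id := by
  have hmem (w : V) : w ∈ (⨅ n : N, (ρ n).eqLocus LinearMap.id) ↔ ∀ n ∈ N, ρ n w = w := by
    simp
  rcases hirr (⨅ n : N, (ρ n).eqLocus LinearMap.id) (fun g w hw => by
    rw [hmem] at hw ⊢
    intro n hn
    have h := hw _ (‹N.Normal›.conj_mem' n hn g)
    calc ρ n (ρ g w) = ρ g (ρ (g⁻¹ * n * g) w) := by
          simp only [← Module.End.mul_apply, ← map_mul]; group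
      _ = ρ g w := by rw [h]) with hbot | htop
  · exact absurd ((Submodule.mem_bot ℂ).mp (hbot ▸ (hmem v).mpr hfix)) hv
  · intro n hn
    ext w
    exact (hmem w).mp (htop ▸ Submodule.mem_top) n hn

end Representation

namespace Subgroup

variable {G : Type*} [Group G]

/-- The elements of `G` whose conjugation action on the normal subgroup `N` preserves the
function `χ`. -/
def conjStabilizer {α : Type*} (N : Subgroup G) [N.Normal] (χ : G → α) : Subgroup G where
  carrier := {g | ∀ n ∈ N, χ (g⁻¹ * n * g) = χ n}
  one_mem' := by simp
  mul_mem' {a b} ha hb n hn := by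
    rw [← ha n hn, ← hb _ (‹N.Normal›.conj_mem' n hn a)]
    group
  inv_mem' {a} ha n hn := by
    have h := ha _ (‹N.Normal›.conj_mem n hn a)
    calc χ (a⁻¹⁻¹ * n * a⁻¹) = χ (a * n * a⁻¹) := by rw [inv_inv]
      _ = χ n := by rw [← h]; group

theorem mem_of_pow_mem_of_coprime (H : Subgroup G) {z : G} {m n : ℕ} (hmn : m.Coprime n)
    (hm : z ^ m ∈ H) (hn : z ^ n ∈ H) : z ∈ H := by
  have hbez := Nat.gcd_eq_gcd_ab m n
  rw [hmn.gcd_eq_one] at hbez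
  have hz : z = (z ^ m) ^ m.gcdA n * (z ^ n) ^ m.gcdB n := by
    rw [← zpow_natCast, ← zpow_natCast, ← zpow_mul, ← zpow_mul, ← zpow_add, ← hbez]
    simp
  rw [hz]
  exact H.mul_mem (H.zpow_mem hm _) (H.zpow_mem hn _)

/-- If conjugation by `z` fixes no nontrivial element of the finite normal subgroup `N`, then
every element of `N` is of the form `m⁻¹ * (z⁻¹ * m * z)`. -/
theorem exists_eq_inv_mul_conj [Finite G] (N : Subgroup G) [N.Normal] {z : G}
    (hfix : ∀ n ∈ N, z * n * z⁻¹ = n → n = 1) {n : G} (hn : n ∈ N) :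
    ∃ m ∈ N, n = m⁻¹ * (z⁻¹ * m * z) := by
  let φ : N → N := fun m =>
    ⟨(m : G)⁻¹ * (z⁻¹ * m * z), N.mul_mem (N.inv_mem m.2) (‹N.Normal›.conj_mem' _ m.2 z)⟩
  have hφ : Function.Injective φ := by
    intro a b hab
    have h : (a : G)⁻¹ * (z⁻¹ * a * z) = (b : G)⁻¹ * (z⁻¹ * b * z) := congrArg Subtype.val hab
    have h1 := hfix ((b : G) * (a : G)⁻¹) (N.mul_mem b.2 (N.inv_mem a.2)) (by
      have h2 : (b : G) * (a : G)⁻¹ = z⁻¹ * (b * (a : G)⁻¹) * z := by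
        calc (b : G) * (a : G)⁻¹ = b * ((a : G)⁻¹ * (z⁻¹ * a * z)) * (z⁻¹ * (a : G)⁻¹ * z) := by
              group
          _ = z⁻¹ * (b * (a : G)⁻¹) * z := by rw [h]; group
      nth_rewrite 1 [h2]
      group)
    exact (Subtype.ext (mul_inv_eq_one.mp h1)).symm
  obtain ⟨m, hm⟩ := Finite.surjective_of_injective hφ ⟨n, hn⟩
  exact ⟨m, m.2, (congrArg Subtype.val hm).symm⟩

/-- If the index of the normal subgroup `N` is a power of `p` and `z` generates a Sylow
`p`-subgroup, then `N` and `z` generate `G`. -/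
theorem exists_eq_mul_pow_of_sylow [Finite G] (N : Subgroup G) [N.Normal] {p h : ℕ}
    (hp : p.Prime) (hN : N.index = p ^ h) {z : G}
    (hz : ∃ P : Sylow p G, (P : Subgroup G) = zpowers z) (g : G) :
    ∃ n ∈ N, ∃ k : ℕ, g = n * z ^ k := by
  have := Fact.mk hp
  obtain ⟨P, hP⟩ := hz
  have hnd := P.not_dvd_index
  rw [hP] at hnd
  have h1 : (N ⊔ zpowers z).index = 1 := by
    have hcop : (p ^ h).Coprime (zpowers z).index := ((hp.coprime_iff_not_dvd).mpr hnd).pow_left h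
    exact Nat.eq_one_of_dvd_coprimes hcop (hN ▸ index_dvd_of_le le_sup_left)
      (index_dvd_of_le le_sup_right)
  have hg : g ∈ (N ⊔ zpowers z) := index_eq_one.mp h1 ▸ mem_top g
  obtain ⟨n, hn, y, hy, rfl⟩ := mem_sup_of_normal_left.mp hg
  obtain ⟨k, rfl⟩ := mem_powers_iff_mem_zpowers.mpr hy
  exact ⟨n, hn, k, rfl⟩

end Subgroup

namespace Representation

variable {G V : Type*} [Group G] [AddCommGroup V] [Module ℂ V] {ρ : Representation ℂ G V}
  {N : Subgroup G} [N.Normal] {z : G} {p : ℕ} {v : V} {χ : G → ℂ}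

theorem apply_apply_of_common_eigenvector (hχ : ∀ n ∈ N, ρ n v = χ n • v) (a : G) {n : G}
    (hn : n ∈ N) : ρ n (ρ a v) = χ (a⁻¹ * n * a) • ρ a v := by
  rw [← map_smul, ← hχ _ (‹N.Normal›.conj_mem' n hn a)]
  simp only [← Module.End.mul_apply, ← map_mul]
  group

/-- The translates by `z ^ i` of a common eigenvector of `N` span an irreducible representation
when `N` and `z` generate `G` and `z ^ p` acts on the eigenvector by a scalar. -/
theorem finrank_le_of_common_eigenvector
    (hirr : ∀ W : Submodule ℂ V, (∀ g : G, ∀ v ∈ W, ρ g v ∈ W) → W = ⊥ ∨ W = ⊤)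
    (hgen : ∀ g : G, ∃ n ∈ N, ∃ k : ℕ, g = n * z ^ k) (hp : 0 < p) (hv : v ≠ 0)
    (hχ : ∀ n ∈ N, ρ n v = χ n • v) {c : ℂ} (hc : ρ (z ^ p) v = c • v) :
    Module.finrank ℂ V ≤ p := by
  set W := Submodule.span ℂ (Set.range fun i : Fin p => ρ (z ^ (i : ℕ)) v) with hW
  have hpow (k : ℕ) : ρ (z ^ k) v ∈ W := by
    have hck (j : ℕ) : ρ ((z ^ p) ^ j) v = c ^ j • v := by
      induction j with
      | zero => simp
      | succ j ih => rw [pow_succ', map_mul, Module.End.mul_apply, ih, map_smul, hc, smul_smul,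
          pow_succ]
    rw [← Nat.mod_add_div k p, pow_add, map_mul, Module.End.mul_apply, pow_mul, hck, map_smul]
    exact W.smul_mem _ (Submodule.subset_span ⟨⟨k % p, Nat.mod_lt _ hp⟩, rfl⟩)
  rcases hirr W (fun g w hw => by
    obtain ⟨n, hn, k, rfl⟩ := hgen g
    induction hw using Submodule.span_induction with
    | mem x hx =>
      obtain ⟨i, rfl⟩ := hx
      rw [← Module.End.mul_apply, ← map_mul, mul_assoc, ← pow_add, map_mul, Module.End.mul_apply,
        apply_apply_of_common_eigenvector hχ _ hn]
      exact W.smul_mem _ (hpow _)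
    | zero => simp
    | add x y _ _ hx hy => rw [map_add]; exact Submodule.add_mem _ hx hy
    | smul c x _ hx => rw [map_smul]; exact Submodule.smul_mem _ c hx) with hbot | htop
  · have h0 := hpow 0
    rw [hbot, Submodule.mem_bot] at h0
    exact absurd (by simpa using h0) hv
  · rw [← finrank_top, ← htop]
    exact (finrank_range_le_card _).trans_eq (Fintype.card_fin p)

/-- If `N` moves a common eigenvector `v`, then the systems of eigenvalues of the translates of
`v` by `z ^ i`, `i < p`, are distinct. -/
theorem injective_eigenvalues_of_not_fixed [Finite G] (hp : p.Prime)
    (hzp : ∀ n ∈ N, z ^ p * n * (z ^ p)⁻¹ = n) (hzfix : ∀ n ∈ N, z * n * z⁻¹ = n → n = 1)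
    (hχ : ∀ n ∈ N, ρ n v = χ n • v) (hnf : ¬ ∀ n ∈ N, ρ n v = v) :
    Function.Injective fun (i : Fin p) (n : N) => χ ((z ^ (i : ℕ))⁻¹ * n * z ^ (i : ℕ)) := by
  have hz : z ∉ N.conjStabilizer χ := by
    refine fun hz => hnf fun n hn => ?_
    obtain ⟨m, hm, rfl⟩ := N.exists_eq_inv_mul_conj hzfix hn
    rw [map_mul, Module.End.mul_apply, hχ _ (‹N.Normal›.conj_mem' m hm z), hz m hm, ← hχ m hm,
      ← Module.End.mul_apply, ← map_mul, inv_mul_cancel, map_one, Module.End.one_apply]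
  have hzpmem : z ^ p ∈ N.conjStabilizer χ := by
    intro n hn
    congr 1
    nth_rewrite 1 [← hzp n hn]
    group
  have hlt (i j : Fin p) (hij : i < j) : ¬ ∀ n ∈ N,
      χ ((z ^ (i : ℕ))⁻¹ * n * z ^ (i : ℕ)) = χ ((z ^ (j : ℕ))⁻¹ * n * z ^ (j : ℕ)) := by
    intro h
    obtain ⟨k, hk⟩ := Nat.exists_eq_add_of_lt (Fin.lt_def.mp hij)
    refine hz (Subgroup.mem_of_pow_mem_of_coprime _
      (Nat.coprime_of_lt_prime k.succ_ne_zero (by omega) hp) hzpmem fun n hn => ?_)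
    have hn' := h _ (‹N.Normal›.conj_mem n hn (z ^ (i : ℕ)))
    have e1 : (z ^ (i : ℕ))⁻¹ * (z ^ (i : ℕ) * n * (z ^ (i : ℕ))⁻¹) * z ^ (i : ℕ) = n := by group
    have e2 : (z ^ (j : ℕ))⁻¹ * (z ^ (i : ℕ) * n * (z ^ (i : ℕ))⁻¹) * z ^ (j : ℕ) =
        (z ^ (k + 1))⁻¹ * n * z ^ (k + 1) := by
      rw [hk, add_assoc, pow_add]; group
    rw [e1, e2] at hn'
    exact hn'.symm
  intro i j hij
  have hij' (n : G) (hn : n ∈ N) := congrFun hij ⟨n, hn⟩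
  rcases lt_trichotomy i j with h | h | h
  · exact absurd hij' (hlt i j h)
  · exact h
  · exact absurd (fun n hn => (hij' n hn).symm) (hlt j i h)

end Representation

/-- Let `p ≠ q` be primes and `G` a finite group such that: the commutator subgroup
`N = [G,G]` is abelian and is a Sylow `q`-subgroup of `G`; the quotient `G/N` (the
abelianization) is cyclic of order `p^h` with `h ≥ 1`; and some `z ∈ G` generates a
Sylow `p`-subgroup of `G`, conjugation by `z^p` acts trivially on `N`, and
conjugation by `z` fixes no nontrivial element of `N`.  Then every irreducible
complex representation of `G` has dimension `1` or `p`, and the one-dimensional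
ones are exactly those that are trivial on `N`. -/
theorem stmt_18 {G : Type*} [Group G] [Finite G] {p q : ℕ}
    (hp : p.Prime) (hq : q.Prime) (hpq : p ≠ q)
    (habel : ∀ a b : ↥(commutator G), a * b = b * a)
    (hsylq : ∃ Q : Sylow q G, (Q : Subgroup G) = commutator G)
    {h : ℕ} (hh : 1 ≤ h)
    (hcyc : IsCyclic (Abelianization G)) (hcard : Nat.card (Abelianization G) = p ^ h)
    (z : G) (hsylp : ∃ P : Sylow p G, (P : Subgroup G) = Subgroup.zpowers z)
    (hzp : ∀ n ∈ commutator G, z ^ p * n * (z ^ p)⁻¹ = n)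
    (hzfix : ∀ n ∈ commutator G, z * n * z⁻¹ = n → n = 1) :
    ∀ (V : Type) [AddCommGroup V] [Module ℂ V] [Nontrivial V]
      (ρ : Representation ℂ G V),
      (∀ W : Submodule ℂ V, (∀ g : G, ∀ v ∈ W, ρ g v ∈ W) → W = ⊥ ∨ W = ⊤) →
      ((Module.finrank ℂ V = 1 ∨ Module.finrank ℂ V = p) ∧
        (Module.finrank ℂ V = 1 ↔ ∀ n ∈ commutator G, ρ n = LinearMap.id)) := by
  intro V _ _ _ ρ hirr
  have hfd := Representation.finiteDimensional_of_irreducible hirr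
  have hgen := (commutator G).exists_eq_mul_pow_of_sylow hp hcard hsylp
  have htriv (hN : ∀ n ∈ commutator G, ρ n = LinearMap.id) : Module.finrank ℂ V = 1 := by
    refine Representation.finrank_eq_one_of_irreducible_of_commute hirr fun a b => ?_
    obtain ⟨n, hn, k, rfl⟩ := hgen a
    obtain ⟨m, hm, l, rfl⟩ := hgen b
    rw [map_mul, map_mul, hN n hn, hN m hm, map_pow, map_pow]
    exact ((Commute.refl (ρ z)).pow_pow k l)
  refine ⟨?_, fun h1 n hn => Representation.eq_id_of_mem_commutator_of_finrank_eq_one h1 hn, htriv⟩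
  by_cases hN : ∀ n ∈ commutator G, ρ n = LinearMap.id
  · exact Or.inl (htriv hN)
  right
  have hcomm (a b : commutator G) : Commute (ρ a) (ρ b) := by
    rw [Commute, SemiconjBy, ← map_mul, ← map_mul, ← Subgroup.coe_mul, habel, Subgroup.coe_mul]
  obtain ⟨v, χ', hv, hχ'⟩ := Module.End.exists_common_eigenvector_of_pow_eq_one
    (fun n : commutator G => ρ n) hcomm (m := Nat.card G) Nat.card_pos.ne'
    (fun n => by rw [← map_pow, pow_card_eq_one', map_one])
  obtain ⟨χ, hχ⟩ : ∃ χ : G → ℂ, ∀ n ∈ commutator G, ρ n v = χ n • v := by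
    classical
    exact ⟨fun n => if hn : n ∈ commutator G then χ' ⟨n, hn⟩ else 0,
      fun n hn => by simpa [hn] using hχ' ⟨n, hn⟩⟩
  have hnf : ¬ ∀ n ∈ commutator G, ρ n v = v := fun hfix =>
    hN (Representation.eq_id_of_irreducible_of_fixed_vector hirr hv hfix)
  obtain ⟨c, hc⟩ := Representation.exists_scalar_of_irreducible hirr (ρ (z ^ p)) (fun g => by
    obtain ⟨n, hn, k, rfl⟩ := hgen g
    have hzn : Commute (z ^ p) n := mul_inv_eq_iff_eq_mul.mp (hzp n hn)
    exact (hzn.mul_right ((Commute.refl z).pow_pow p k)).map ρ)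
  refine le_antisymm
    (Representation.finrank_le_of_common_eigenvector hirr hgen hp.pos hv hχ (hc v)) ?_
  have hind := Module.End.linearIndependent_of_common_eigenvectors
    (fun n : commutator G => ρ n) hcomm _
    (Representation.injective_eigenvalues_of_not_fixed hp hzp hzfix hχ hnf)
    (fun i : Fin p => ρ (z ^ (i : ℕ)) v)
    (fun i hi => hv (by simpa [← map_pow] using congrArg (ρ (z ^ (i : ℕ))⁻¹) hi))
    (fun i n => Representation.apply_apply_of_common_eigenvector hχ _ n.2)
  simpa using hind.fintype_card_le_finrank
end

section
/- Let p ≠ q be primes and let G be a finite group such that: the commutator subgroup N = [G,G] is abelian and is a Sylow q-subgroup of G; the quotient G/N is cyclic of order p^h for some h ≥ 1; and there is an element z ∈ G generating a Sylow p-subgroup of G such that conjugation by z^p acts trivially on N while conjugation by z fixes no nontrivial element of N. If ρ : G → GL(V) is an irreducible complex representation of G that is nontrivial on N and satisfies ρ(z^p) = id, then 1 is an eigenvalue of ρ(z). -/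
/-- If coprime powers of `z` commute with `n`, then so does `z`. -/
theorem Commute.of_pow_left_of_coprime {G : Type*} [Group G] {z n : G} {i j : ℕ}
    (hij : i.Coprime j) (hi : Commute (z ^ i) n) (hj : Commute (z ^ j) n) : Commute z n := by
  have hz : z = (z ^ i) ^ i.gcdA j * (z ^ j) ^ i.gcdB j := by
    have h := Nat.gcd_eq_gcd_ab i j
    rw [hij.gcd_eq_one] at h
    rw [← zpow_natCast, ← zpow_natCast, ← zpow_mul, ← zpow_mul, ← zpow_add, ← h]
    simp
  rw [hz]
  exact (hi.zpow_left _).mul_left (hj.zpow_left _)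

/-- If `g` commutes with no nontrivial element of a finite normal subgroup `N`, then
`m ↦ m⁻¹ (g m g⁻¹)` is a permutation of `N`. -/
theorem Subgroup.bijective_inv_mul_conjNormal {G : Type*} [Group G] (N : Subgroup G) [N.Normal]
    [Finite N] (g : G) (hg : ∀ n ∈ N, Commute g n → n = 1) :
    Function.Bijective (fun m : N => m⁻¹ * MulAut.conjNormal g m) := by
  refine Finite.injective_iff_bijective.mp fun a b hab => ?_
  have hab : a⁻¹ * MulAut.conjNormal g a = b⁻¹ * MulAut.conjNormal g b := hab
  have hfix : MulAut.conjNormal g (b * a⁻¹) = b * a⁻¹ := by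
    rw [map_mul, map_inv, mul_inv_eq_iff_eq_mul, mul_assoc, hab, mul_inv_cancel_left]
  have hone : ((b * a⁻¹ : N) : G) = 1 := by
    refine hg _ (b * a⁻¹).2 ?_
    have := congrArg Subtype.val hfix
    rw [MulAut.conjNormal_apply] at this
    exact mul_inv_eq_iff_eq_mul.mp this
  exact (mul_inv_eq_one.mp (Subtype.ext hone)).symm

/-- Averaging `ρ g` over conjugation by `N` gives `(∑ m : N, ρ m) * ρ g` when `g` centralizes no
nontrivial element of the finite normal subgroup `N`. -/
theorem Representation.sum_conj_eq {k G V : Type*} [CommSemiring k] [Group G] [AddCommMonoid V]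
    [Module k V] (ρ : Representation k G V) (N : Subgroup G) [N.Normal] [Fintype N] (g : G)
    (hg : ∀ n ∈ N, Commute g n → n = 1) :
    ∑ m : N, ρ (m : G)⁻¹ * ρ g * ρ m = (∑ m : N, ρ m) * ρ g := by
  rw [Finset.sum_mul,
    ← (N.bijective_inv_mul_conjNormal g hg).sum_comp (fun m : N => ρ m * ρ g)]
  refine Finset.sum_congr rfl fun m _ => ?_
  simp only [← map_mul, Subgroup.coe_mul, Subgroup.coe_inv, MulAut.conjNormal_apply]
  congr 1
  group


/-- Let `p ≠ q` be primes and `G` a finite group such that: the commutator subgroup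
`N = [G,G]` is abelian and is a Sylow `q`-subgroup of `G`; the quotient `G/N` (the
abelianization) is cyclic of order `p^h` with `h ≥ 1`; and some `z ∈ G` generates a
Sylow `p`-subgroup of `G`, conjugation by `z^p` acts trivially on `N`, and
conjugation by `z` fixes no nontrivial element of `N`.  If `ρ` is an irreducible
complex representation of `G` that is nontrivial on `N` and satisfies
`ρ (z^p) = id`, then `1` is an eigenvalue of `ρ z`. -/
theorem stmt_19 {G : Type*} [Group G] [Finite G] {p q : ℕ}
    (hp : p.Prime) (hq : q.Prime) (hpq : p ≠ q)
    (habel : ∀ a b : ↥(commutator G), a * b = b * a)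
    (hsylq : ∃ Q : Sylow q G, (Q : Subgroup G) = commutator G)
    {h : ℕ} (hh : 1 ≤ h)
    (hcyc : IsCyclic (Abelianization G)) (hcard : Nat.card (Abelianization G) = p ^ h)
    (z : G) (hsylp : ∃ P : Sylow p G, (P : Subgroup G) = Subgroup.zpowers z)
    (hzp : ∀ n ∈ commutator G, z ^ p * n * (z ^ p)⁻¹ = n)
    (hzfix : ∀ n ∈ commutator G, z * n * z⁻¹ = n → n = 1)
    {V : Type*} [AddCommGroup V] [Module ℂ V] [Nontrivial V]
    (ρ : Representation ℂ G V)
    (hirr : ∀ W : Submodule ℂ V, (∀ g : G, ∀ v ∈ W, ρ g v ∈ W) → W = ⊥ ∨ W = ⊤)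
    (hNnontriv : ∃ n ∈ commutator G, ρ n ≠ LinearMap.id)
    (hzpid : ρ (z ^ p) = LinearMap.id) :
    ∃ v : V, v ≠ 0 ∧ ρ z v = v := by
  classical
  have : Fintype (commutator G) := Fintype.ofFinite _
  by_contra! hno
  set S : Module.End ℂ V := ∑ i ∈ Finset.range p, ρ z ^ i with hS
  have hS0 : S = 0 := by
    have hgeom : (ρ z - 1) * S = 0 := by
      rw [hS, mul_geom_sum, ← map_pow, hzpid]
      exact sub_self _
    ext v
    by_contra hv
    refine hno (S v) hv (sub_eq_zero.mp ?_)
    exact LinearMap.congr_fun hgeom v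
  set E : Module.End ℂ V := ∑ m : commutator G, ρ m with hE
  have hpow : ∀ i ∈ Finset.range p, i ≠ 0 →
      ∑ m : commutator G, ρ (m : G)⁻¹ * ρ z ^ i * ρ m = E * ρ z ^ i := by
    intro i hi hi0
    rw [← map_pow]
    refine ρ.sum_conj_eq _ _ fun n hn hcomm => hzfix n hn ?_
    have hcop : i.Coprime p :=
      (Nat.coprime_of_lt_prime hi0 (Finset.mem_range.mp hi) hp).symm
    exact mul_inv_eq_iff_eq_mul.mpr
      (Commute.of_pow_left_of_coprime hcop hcomm (mul_inv_eq_iff_eq_mul.mp (hzp n hn)))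
  have havg : ∑ i ∈ Finset.range p, ∑ m : commutator G, ρ (m : G)⁻¹ * ρ z ^ i * ρ m = 0 := by
    rw [Finset.sum_comm]
    refine Finset.sum_eq_zero fun m _ => ?_
    rw [← Finset.sum_mul, ← Finset.mul_sum, ← hS, hS0, mul_zero, zero_mul]
  have hmem : 0 ∈ Finset.range p := Finset.mem_range.mpr hp.pos
  have hES : E + ∑ i ∈ (Finset.range p).erase 0, E * ρ z ^ i = 0 := by
    have h0 : ∑ i ∈ Finset.range p, E * ρ z ^ i = 0 := by
      rw [← Finset.mul_sum, ← hS, hS0, mul_zero]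
    rw [← Finset.add_sum_erase _ _ hmem] at h0
    simpa using h0
  have hEcard : E = (Fintype.card (commutator G) : Module.End ℂ V) := by
    rw [← Finset.add_sum_erase _ _ hmem, Finset.sum_congr rfl fun i hi =>
      hpow i (Finset.mem_of_mem_erase hi) (Finset.ne_of_mem_erase hi)] at havg
    have hid : ∑ m : commutator G, ρ (m : G)⁻¹ * ρ z ^ 0 * ρ m =
        (Fintype.card (commutator G) : Module.End ℂ V) := by
      simp [← map_mul]
    rw [hid] at havg
    exact add_right_cancel (hES.trans havg.symm)
  obtain ⟨n, hn, hne⟩ := hNnontriv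
  refine hne (LinearMap.ext fun v => ?_)
  have hnE : ρ n * E = E := by
    rw [hE, Finset.mul_sum,
      ← Equiv.sum_comp (Equiv.mulLeft (⟨n, hn⟩ : commutator G)) (fun m : commutator G => ρ m)]
    simp
  have hcard0 : (Fintype.card (commutator G) : ℂ) ≠ 0 := Nat.cast_ne_zero.mpr Fintype.card_ne_zero
  rw [hEcard] at hnE
  have hv := LinearMap.congr_fun hnE v
  simp only [Module.End.mul_apply, Module.End.natCast_apply,
    ← Nat.cast_smul_eq_nsmul ℂ, map_smul] at hv
  exact smul_right_injective V hcard0 hv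
end
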